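/- arXiv:1411.7116 — 4 statements merged into one kernel-verified Lean document; each statement's English description precedes it below -/
import Mathlib

section
/- Let E ⊆ ℝ^d and F ⊆ ℝ^{d'} be dust-like self-similar sets with contraction vectors ρ = (ρ_1,…,ρ_m) and τ = (τ_1,…,τ_n) respectively, where m, n ≥ 2. If E and F are Lipschitz equivalent, then there exist positive integers p and q such that sgp(ρ_1^p,…,ρ_m^p) ⊆ sgp(τ_1,…,τ_n) and sgp(τ_1^q,…,τ_n^q) ⊆ sgp(ρ_1,…,ρ_m). -/
open scoped BigOperators

noncomputable section

/-- `E ⊆ ℝ^d` is a dust-like self-similar set with contraction vector `ρ`: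
`E` is nonempty compact, each `ρ j ∈ (0,1)`, and there are similarities `φ j`
with ratios `ρ j` such that `E = ⋃ j, φ j '' E` is a disjoint union. -/
def IsDustLike {d : ℕ} {ι : Type} [Fintype ι]
    (E : Set (EuclideanSpace ℝ (Fin d))) (ρ : ι → ℝ) : Prop :=
  IsCompact E ∧ E.Nonempty ∧ (∀ j, ρ j ∈ Set.Ioo (0 : ℝ) 1) ∧
  ∃ φ : ι → EuclideanSpace ℝ (Fin d) → EuclideanSpace ℝ (Fin d),
    (∀ j x y, dist (φ j x) (φ j y) = ρ j * dist x y) ∧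
    E = ⋃ j, φ j '' E ∧
    Pairwise fun j k => Disjoint (φ j '' E) (φ k '' E)

/-- `E` and `F` are Lipschitz equivalent: there is a bi-Lipschitz bijection between them. -/
def LipEquiv {d d' : ℕ} (E : Set (EuclideanSpace ℝ (Fin d)))
    (F : Set (EuclideanSpace ℝ (Fin d'))) : Prop :=
  ∃ f : E → F, Function.Bijective f ∧ ∃ C : ℝ, 0 < C ∧ ∀ x y : E,
    C⁻¹ * dist (x : EuclideanSpace ℝ (Fin d)) (y : EuclideanSpace ℝ (Fin d))
      ≤ dist (f x : EuclideanSpace ℝ (Fin d')) (f y : EuclideanSpace ℝ (Fin d')) ∧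
    dist (f x : EuclideanSpace ℝ (Fin d')) (f y : EuclideanSpace ℝ (Fin d'))
      ≤ C * dist (x : EuclideanSpace ℝ (Fin d)) (y : EuclideanSpace ℝ (Fin d))

/-- The multiplicative semigroup generated by `a_1, …, a_m`. -/
def sgp {m : ℕ} (a : Fin m → ℝ) : Set ℝ :=
  { x | ∃ n : Fin m → ℕ, 1 ≤ ∑ i, n i ∧ x = ∏ i, a i ^ n i }

namespace FM

def Phi {X : Type*} {m : ℕ} (φ : Fin m → X → X) (w : List (Fin m)) (y : X) : X :=
  w.foldr (fun j z => φ j z) y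

def W {m : ℕ} (τ : Fin m → ℝ) (w : List (Fin m)) : ℝ := (w.map τ).prod

structure Dust {X : Type*} [MetricSpace X] {m : ℕ} (ρ : Fin m → ℝ) (φ : Fin m → X → X) : Prop where
  pos : ∀ j, 0 < ρ j
  lt1 : ∀ j, ρ j < 1
  dst : ∀ j x y, dist (φ j x) (φ j y) = ρ j * dist x y
  srj : ∀ x, ∃ j y, φ j y = x
  dsj : ∀ j k x y, φ j x = φ k y → j = k

section words
variable {X : Type*} {m : ℕ} (φ : Fin m → X → X) (τ : Fin m → ℝ)

lemma Phi_nil (y : X) : Phi φ [] y = y := rfl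
lemma Phi_cons (j : Fin m) (w : List (Fin m)) (y : X) : Phi φ (j :: w) y = φ j (Phi φ w y) := rfl
lemma Phi_append (w v : List (Fin m)) (y : X) : Phi φ (w ++ v) y = Phi φ w (Phi φ v y) := by
  simp [Phi]

lemma W_nil : W τ [] = 1 := by simp [W]
lemma W_cons (j : Fin m) (w : List (Fin m)) : W τ (j :: w) = τ j * W τ w := by simp [W]
lemma W_append (w v : List (Fin m)) : W τ (w ++ v) = W τ w * W τ v := by simp [W]
lemma W_single (j : Fin m) : W τ [j] = τ j := by simp [W]
lemma W_replicate (j : Fin m) (l : ℕ) : W τ (List.replicate l j) = τ j ^ l := by simp [W]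

variable {τ}
lemma W_pos (h : ∀ j, 0 < τ j) (w : List (Fin m)) : 0 < W τ w := by
  induction w with
  | nil => simp [W_nil]
  | cons j w ih => rw [W_cons]; exact mul_pos (h j) ih

lemma W_le_pow (h : ∀ j, 0 < τ j) {b : ℝ} (hb : ∀ j, τ j ≤ b) (w : List (Fin m)) :
    W τ w ≤ b ^ w.length := by
  induction w with
  | nil => simp [W_nil]
  | cons j w ih =>
    rw [W_cons, List.length_cons, pow_succ']
    exact mul_le_mul (hb j) ih (W_pos h w).le ((h j).le.trans (hb j))

lemma pow_le_W {b : ℝ} (hb0 : 0 ≤ b) (hb : ∀ j, b ≤ τ j) (w : List (Fin m)) :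
    b ^ w.length ≤ W τ w := by
  induction w with
  | nil => simp [W_nil]
  | cons j w ih =>
    rw [W_cons, List.length_cons, pow_succ']
    exact mul_le_mul (hb j) ih (by positivity) (hb0.trans (hb j))

lemma W_le_one (h : ∀ j, 0 < τ j) (hb : ∀ j, τ j ≤ 1) (w : List (Fin m)) : W τ w ≤ 1 := by
  simpa using W_le_pow h hb w

lemma W_rpow (h : ∀ j, 0 < τ j) (t : ℝ) (w : List (Fin m)) :
    W (fun j => τ j ^ t) w = (W τ w) ^ t := by
  induction w with
  | nil => simp [W_nil]
  | cons j w ih => rw [W_cons, W_cons, ih, Real.mul_rpow (h j).le (W_pos h w).le]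

lemma exists_max (h1 : ∀ j, τ j < 1) : ∃ b : ℝ, 0 < b ∧ b < 1 ∧ ∀ j, τ j ≤ b := by
  rcases isEmpty_or_nonempty (Fin m) with hE | hE
  · exact ⟨1/2, by norm_num, by norm_num, fun j => (hE.false j).elim⟩
  · obtain ⟨j, hj⟩ := Finite.exists_max τ
    exact ⟨max (τ j) (1/2), by positivity, by simp [h1 j]; norm_num,
      fun k => (hj k).trans (le_max_left _ _)⟩

lemma exists_min' (h1 : ∀ j, 0 < τ j) : ∃ b : ℝ, 0 < b ∧ ∀ j, b ≤ τ j := by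
  rcases isEmpty_or_nonempty (Fin m) with hE | hE
  · exact ⟨1/2, by norm_num, fun j => (hE.false j).elim⟩
  · obtain ⟨j, hj⟩ := Finite.exists_min τ
    exact ⟨τ j, h1 j, hj⟩

end words

section dust
variable {X : Type*} [MetricSpace X] {m : ℕ} {φ : Fin m → X → X} {ρ : Fin m → ℝ}

lemma Dust.inj (h : Dust ρ φ) (j : Fin m) : Function.Injective (φ j) := by
  intro x y hxy
  have := h.dst j x y
  rw [hxy, dist_self] at this
  have h2 := h.pos j
  rcases mul_eq_zero.1 this.symm with h3 | h3
  · linarith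
  · exact dist_eq_zero.1 h3

lemma Dust.dist_Phi (h : Dust ρ φ) (w : List (Fin m)) (x y : X) :
    dist (Phi φ w x) (Phi φ w y) = W ρ w * dist x y := by
  induction w with
  | nil => simp [W_nil, Phi_nil]
  | cons j w ih => rw [Phi_cons, Phi_cons, h.dst, ih, W_cons, mul_assoc]

lemma Dust.inj_Phi (h : Dust ρ φ) (w : List (Fin m)) : Function.Injective (Phi φ w) := by
  induction w with
  | nil => exact fun x y hh => hh
  | cons j w ih => exact fun x y hh => ih (h.inj j hh)

lemma Dust.exists_word (h : Dust ρ φ) (N : ℕ) (x : X) :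
    ∃ w : List (Fin m), w.length = N ∧ x ∈ Set.range (Phi φ w) := by
  induction N generalizing x with
  | zero => exact ⟨[], rfl, x, rfl⟩
  | succ N ih =>
    obtain ⟨j, y, rfl⟩ := h.srj x
    obtain ⟨w, hw, z, rfl⟩ := ih y
    exact ⟨j :: w, by simp [hw], z, rfl⟩

lemma Dust.word_unique (h : Dust ρ φ) (w v : List (Fin m)) (hl : w.length = v.length)
    (x y : X) (he : Phi φ w x = Phi φ v y) : w = v := by
  induction w generalizing v with
  | nil => simp at hl; exact (List.length_eq_zero_iff.1 hl.symm).symm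
  | cons j w ih =>
    cases v with
    | nil => simp at hl
    | cons k v =>
      rw [Phi_cons, Phi_cons] at he
      obtain rfl := h.dsj _ _ _ _ he
      rw [ih v (by simpa using hl) (h.inj _ he)]

lemma Dust.exists_sep [CompactSpace X] [Nonempty X] (h : Dust ρ φ) :
    ∃ δ : ℝ, 0 < δ ∧ ∀ j k, j ≠ k → ∀ x y, δ ≤ dist (φ j x) (φ k y) := by
  have hc : ∀ j, Continuous (φ j) := fun j => by
    have : LipschitzWith (Real.toNNReal (ρ j)) (φ j) := LipschitzWith.of_dist_le_mul (by
      intro x y; rw [h.dst, Real.coe_toNNReal _ (h.pos j).le])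
    exact this.continuous
  have h1 : ∀ p : Fin m × Fin m, ∃ δ : ℝ, 0 < δ ∧
      (p.1 ≠ p.2 → ∀ x y, δ ≤ dist (φ p.1 x) (φ p.2 y)) := by
    rintro ⟨j, k⟩
    by_cases hjk : j = k
    · exact ⟨1, one_pos, fun hh => (hh hjk).elim⟩
    · obtain ⟨z, -, hz⟩ := (isCompact_univ (X := X × X)).exists_isMinOn Set.univ_nonempty
        (f := fun z : X × X => dist (φ j z.1) (φ k z.2))
        (((hc j).comp continuous_fst).dist ((hc k).comp continuous_snd)).continuousOn
      refine ⟨_, dist_pos.2 (fun hh => hjk (h.dsj j k z.1 z.2 hh)), fun _ x y => ?_⟩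
      exact hz (Set.mem_univ (x, y))
  choose δ hδ hδ' using h1
  rcases isEmpty_or_nonempty (Fin m × Fin m) with hE | hE
  · exact ⟨1, one_pos, fun j k => (hE.false (j, k)).elim⟩
  · obtain ⟨p, hp⟩ := Finite.exists_min δ
    exact ⟨δ p, hδ p, fun j k hjk x y => (hp (j, k)).trans (hδ' (j, k) hjk x y)⟩

lemma Dust.sep_word (h : Dust ρ φ) {δ : ℝ} (hδ : 0 < δ)
    (hs : ∀ j k, j ≠ k → ∀ x y, δ ≤ dist (φ j x) (φ k y)) (w : List (Fin m)) (x y : X)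
    (hy : y ∉ Set.range (Phi φ w)) : δ * W ρ w ≤ dist (Phi φ w x) y := by
  induction w generalizing y with
  | nil => exact (hy ⟨y, rfl⟩).elim
  | cons j w ih =>
    obtain ⟨k, z, rfl⟩ := h.srj y
    by_cases hjk : j = k
    · subst hjk
      rw [Phi_cons, h.dst, W_cons]
      have := ih z (by rintro ⟨u, rfl⟩; exact hy ⟨u, rfl⟩)
      have := mul_le_mul_of_nonneg_left this (h.pos j).le
      linarith
    · have h1 := hs j k hjk (Phi φ w x) z
      have h2 := W_le_one h.pos (fun j => (h.lt1 j).le) (j :: w)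
      rw [Phi_cons]
      nlinarith

end dust

section content
open Filter Topology
variable {Y : Type*} {n : ℕ}

def T (q : Fin n → ℝ) (ψ : Fin n → Y → Y) (h : Y → ℝ) (y : Y) : ℝ := ∑ j, q j * h (ψ j y)

lemma T_add (q : Fin n → ℝ) (ψ : Fin n → Y → Y) (N : ℕ) (g h : Y → ℝ) :
    (T q ψ)^[N] (g + h) = (T q ψ)^[N] g + (T q ψ)^[N] h := by
  induction N generalizing g h with
  | zero => rfl
  | succ N ih =>
    rw [Function.iterate_succ_apply, Function.iterate_succ_apply, Function.iterate_succ_apply, ← ih]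
    congr 1
    funext y
    simp [T, mul_add, Finset.sum_add_distrib]

lemma T_smul (q : Fin n → ℝ) (ψ : Fin n → Y → Y) (N : ℕ) (c : ℝ) (h : Y → ℝ) :
    (T q ψ)^[N] (fun y => c * h y) = fun y => c * (T q ψ)^[N] h y := by
  induction N generalizing h with
  | zero => rfl
  | succ N ih =>
    rw [Function.iterate_succ_apply, Function.iterate_succ_apply, ← ih]
    congr 1
    funext y
    simp only [T, Finset.mul_sum]
    exact Finset.sum_congr rfl fun j _ => by ring

lemma T_one (q : Fin n → ℝ) (hq1 : ∑ j, q j = 1) (ψ : Fin n → Y → Y) (N : ℕ) :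
    (T q ψ)^[N] (fun _ => 1) = fun _ => 1 := by
  induction N with
  | zero => rfl
  | succ N ih =>
    rw [Function.iterate_succ_apply]
    have : T q ψ (fun _ => 1) = fun _ => 1 := by funext y; simp [T, hq1]
    rw [this, ih]

lemma T_mem (q : Fin n → ℝ) (hq : ∀ j, 0 < q j) (hq1 : ∑ j, q j = 1) (ψ : Fin n → Y → Y) (N : ℕ)
    (h : Y → ℝ) (hh : ∀ y, h y ∈ Set.Icc (0:ℝ) 1) (y : Y) :
    (T q ψ)^[N] h y ∈ Set.Icc (0:ℝ) 1 := by
  induction N generalizing h with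
  | zero => exact hh y
  | succ N ih =>
    rw [Function.iterate_succ_apply]
    refine ih _ fun z => ⟨Finset.sum_nonneg fun j _ => mul_nonneg (hq j).le (hh _).1, ?_⟩
    rw [← hq1]
    exact Finset.sum_le_sum fun j _ => mul_le_of_le_one_right (hq j).le (hh _).2

lemma T_cyl (q : Fin n → ℝ) (hq1 : ∑ j, q j = 1) (ψ : Fin n → Y → Y)
    (hinj : ∀ j, Function.Injective (ψ j)) (hdsj : ∀ j k x y, ψ j x = ψ k y → j = k)
    (w : List (Fin n)) (N : ℕ) (hN : w.length ≤ N) :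
    (T q ψ)^[N] (Set.indicator (Set.range (Phi ψ w)) (fun _ => 1)) = fun _ => W q w := by
  induction w generalizing N with
  | nil =>
    have : Set.range (Phi ψ ([] : List (Fin n))) = Set.univ :=
      Set.eq_univ_of_forall fun y => ⟨y, rfl⟩
    rw [this, Set.indicator_univ, T_one q hq1, W_nil]
  | cons j w ih =>
    obtain ⟨N, rfl⟩ : ∃ M, N = M + 1 := ⟨N - 1, by simp at hN; omega⟩
    rw [Function.iterate_succ_apply]
    have : T q ψ (Set.indicator (Set.range (Phi ψ (j :: w))) (fun _ => 1)) =
        fun y => q j * Set.indicator (Set.range (Phi ψ w)) (fun _ => 1) y := by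
      funext y
      unfold T
      rw [Finset.sum_eq_single j]
      · congr 1
        have : ψ j y ∈ Set.range (Phi ψ (j :: w)) ↔ y ∈ Set.range (Phi ψ w) := by
          constructor
          · rintro ⟨z, hz⟩
            exact ⟨z, hinj j hz⟩
          · rintro ⟨z, rfl⟩
            exact ⟨z, rfl⟩
        by_cases hy : y ∈ Set.range (Phi ψ w)
        · rw [Set.indicator_of_mem hy, Set.indicator_of_mem (this.2 hy)]
        · rw [Set.indicator_of_notMem hy, Set.indicator_of_notMem (fun h => hy (this.1 h))]
      · intro k _ hk
        rw [Set.indicator_of_notMem, mul_zero]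
        rintro ⟨z, hz⟩
        exact hk (hdsj _ _ _ _ hz).symm
      · simp
    rw [this, T_smul, ih N (by simpa using hN), W_cons]

lemma exists_content [Nonempty Y] (q : Fin n → ℝ) (hq : ∀ j, 0 < q j) (hq1 : ∑ j, q j = 1)
    (ψ : Fin n → Y → Y)
    (hinj : ∀ j, Function.Injective (ψ j)) (hdsj : ∀ j k x y, ψ j x = ψ k y → j = k) :
    ∃ ν : Set Y → ℝ, (∀ A, 0 ≤ ν A) ∧ (∀ A B, Disjoint A B → ν (A ∪ B) = ν A + ν B) ∧
      ∀ w, ν (Set.range (Phi ψ w)) = W q w := by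
  obtain ⟨y0⟩ := ‹Nonempty Y›
  let u : Set Y → ℕ → ℝ := fun A N => (T q ψ)^[N] (Set.indicator A (fun _ => 1)) y0
  have hu : ∀ A N, u A N ∈ Set.Icc (0:ℝ) 1 := fun A N => T_mem q hq hq1 ψ N _ (fun y => by
    by_cases hy : y ∈ A
    · simp [hy]
    · simp [hy]) y0
  have key : ∀ A, ∃ a ∈ Set.Icc (0:ℝ) 1, Tendsto (u A) (hyperfilter ℕ : Filter ℕ) (𝓝 a) := by
    intro A
    obtain ⟨a, ha, h⟩ := isCompact_Icc.ultrafilter_le_nhds ((hyperfilter ℕ).map (u A))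
      (by rw [le_principal_iff]; exact Filter.mem_map.2 (Filter.univ_mem' (hu A)))
    exact ⟨a, ha, h⟩
  choose ν hν hlim using key
  refine ⟨ν, fun A => (hν A).1, ?_, ?_⟩
  · intro A B hAB
    refine tendsto_nhds_unique (hlim (A ∪ B)) ?_
    have : u (A ∪ B) = fun N => u A N + u B N := by
      funext N
      simp only [u]
      rw [Set.indicator_union_of_disjoint hAB]
      exact congrFun (T_add q ψ N _ _) y0
    rw [this]
    exact (hlim A).add (hlim B)
  · intro w
    refine tendsto_nhds_unique (hlim _) ?_
    refine tendsto_const_nhds.congr' ?_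
    have : ∀ᶠ N in (hyperfilter ℕ : Filter ℕ), w.length ≤ N :=
      Nat.hyperfilter_le_atTop (eventually_ge_atTop w.length)
    filter_upwards [this] with N hN
    simp only [u]
    rw [T_cyl q hq1 ψ hinj hdsj w N hN]

lemma content_biUnion {ν : Set Y → ℝ} (hadd : ∀ A B, Disjoint A B → ν (A ∪ B) = ν A + ν B)
    {ι : Type*} (s : Finset ι) (F : ι → Set Y)
    (hd : ∀ i ∈ s, ∀ j ∈ s, i ≠ j → Disjoint (F i) (F j)) :
    ν (⋃ i ∈ s, F i) = ∑ i ∈ s, ν (F i) := by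
  classical
  induction s using Finset.induction_on with
  | empty =>
    have := hadd ∅ ∅ (by simp)
    simp at this ⊢
    exact this
  | insert a s ha ih =>
    rw [Finset.set_biUnion_insert, Finset.sum_insert ha, hadd, ih]
    · exact fun i hi j hj => hd i (by simp [hi]) j (by simp [hj])
    · simp only [Set.disjoint_iUnion_right]
      intro i hi
      exact hd a (by simp) i (by simp [hi]) (by rintro rfl; exact ha hi)

end content

lemma exists_exponent {n : ℕ} (hn : 2 ≤ n) (τ : Fin n → ℝ) (h0 : ∀ j, 0 < τ j) (h1 : ∀ j, τ j < 1) :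
    ∃ t : ℝ, 0 < t ∧ ∑ j, τ j ^ t = 1 := by
  have hlim : Filter.Tendsto (fun t : ℝ => ∑ j, τ j ^ t) Filter.atTop (nhds (∑ j : Fin n, 0)) :=
    tendsto_finsetSum _ fun j _ =>
      tendsto_rpow_atTop_of_base_lt_one _ (by linarith [h0 j]) (h1 j)
  simp only [Finset.sum_const_zero] at hlim
  obtain ⟨b, hb1, hb0⟩ := ((hlim.eventually (gt_mem_nhds one_pos)).and
    (Filter.eventually_ge_atTop (0:ℝ))).exists
  have hcont : Continuous (fun t : ℝ => ∑ j, τ j ^ t) :=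
    continuous_finsetSum _ fun j _ => Real.continuous_const_rpow (h0 j).ne'
  have hz : ∑ j, τ j ^ (0:ℝ) = n := by simp
  have hn' : (2:ℝ) ≤ n := by exact_mod_cast hn
  obtain ⟨t, ht, h⟩ := intermediate_value_Icc' hb0 hcont.continuousOn
    (show (1:ℝ) ∈ Set.Icc _ _ from ⟨hb1.le, by simp only [hz]; linarith⟩)
  refine ⟨t, lt_of_le_of_ne ht.1 ?_, h⟩
  rintro rfl
  simp only [hz] at h
  linarith

section main
variable {X Y : Type*} [MetricSpace X] [MetricSpace Y] [CompactSpace X] [CompactSpace Y]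
  [Nonempty X] [Nonempty Y] {m n : ℕ} {ρ : Fin m → ℝ} {τ : Fin n → ℝ}
  {φ : Fin m → X → X} {ψ : Fin n → Y → Y}

lemma geom (hm : 2 ≤ m) (hX : Dust ρ φ) (hY : Dust τ ψ) (f : X ≃ Y) (C : ℝ) (hC : 0 < C)
    (hf : ∀ x y, C⁻¹ * dist x y ≤ dist (f x) (f y) ∧ dist (f x) (f y) ≤ C * dist x y) :
    ∃ C1 > 0, ∃ C2 > 0, ∃ N : ℕ,
      (∀ i w, f '' Set.range (Phi φ i) ⊆ Set.range (Phi ψ w) →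
        ∃ v, f '' Set.range (Phi φ i) ⊆ Set.range (Phi ψ (w ++ v)) ∧ W τ (w ++ v) ≤ C1 * W ρ i) ∧
      (∀ i w, f '' Set.range (Phi φ i) ⊆ Set.range (Phi ψ w) → W ρ i ≤ C2 * W τ w) ∧
      (∀ i w, W τ w ≤ C1 * W ρ i → ∀ k : List (Fin n), k.length = N →
        Set.range (Phi ψ (w ++ k)) ⊆ f '' Set.range (Phi φ i) ∨
        Disjoint (Set.range (Phi ψ (w ++ k))) (f '' Set.range (Phi φ i))) := by
  obtain ⟨δ, hδ, hsep⟩ := hY.exists_sep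
  obtain ⟨ε, hε, hsepX⟩ := hX.exists_sep
  obtain ⟨b, hb0, hb1, hb⟩ := exists_max hY.lt1
  obtain ⟨DX, hDX0, hDX⟩ : ∃ D : ℝ, 0 < D ∧ ∀ x y : X, dist x y ≤ D := by
    obtain ⟨D, hD⟩ := Metric.isBounded_iff.1 (isCompact_univ (X := X)).isBounded
    exact ⟨max D 1, by positivity, fun x y =>
      (hD (Set.mem_univ x) (Set.mem_univ y)).trans (le_max_left _ _)⟩
  obtain ⟨DY, hDY0, hDY⟩ : ∃ D : ℝ, 0 < D ∧ ∀ x y : Y, dist x y ≤ D := by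
    obtain ⟨D, hD⟩ := Metric.isBounded_iff.1 (isCompact_univ (X := Y)).isBounded
    exact ⟨max D 1, by positivity, fun x y =>
      (hD (Set.mem_univ x) (Set.mem_univ y)).trans (le_max_left _ _)⟩
  obtain ⟨a0, a1, ha⟩ : ∃ a0 a1 : X, 0 < dist a0 a1 := by
    obtain ⟨x⟩ := ‹Nonempty X›
    refine ⟨φ ⟨0, by omega⟩ x, φ ⟨1, by omega⟩ x, dist_pos.2 fun h => ?_⟩
    simpa using hX.dsj _ _ _ _ h
  have hWX := W_pos hX.pos
  have hWY := W_pos hY.pos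
  have hlow : ∀ i w, f '' Set.range (Phi φ i) ⊆ Set.range (Phi ψ w) →
      W ρ i ≤ (C * DY / dist a0 a1) * W τ w := by
    intro i w hs
    obtain ⟨z0, hz0⟩ := hs ⟨_, ⟨a0, rfl⟩, rfl⟩
    obtain ⟨z1, hz1⟩ := hs ⟨_, ⟨a1, rfl⟩, rfl⟩
    have h1 := (hf (Phi φ i a0) (Phi φ i a1)).1
    rw [← hz0, ← hz1, hX.dist_Phi, hY.dist_Phi] at h1
    have h2 := mul_le_mul_of_nonneg_left (hDY z0 z1) (hWY w).le
    have h3 := mul_le_mul_of_nonneg_left (h1.trans h2) hC.le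
    rw [← mul_assoc, mul_inv_cancel₀ hC.ne', one_mul] at h3
    rw [div_mul_eq_mul_div, le_div_iff₀ ha]
    linarith
  have hC2 : 0 < C * DY / dist a0 a1 := by positivity
  have hC1 : 0 < C * DX / δ := by positivity
  obtain ⟨N, hN⟩ := exists_pow_lt_of_lt_one
    (show 0 < C⁻¹ * ε / (C * DX / δ) / DY by positivity) hb1
  refine ⟨C * DX / δ, hC1, C * DY / dist a0 a1, hC2, N, ?_, hlow, ?_⟩
  · intro i
    obtain ⟨n0, hn0⟩ := exists_pow_lt_of_lt_one
      (show 0 < W ρ i / (C * DY / dist a0 a1) from div_pos (hWX i) hC2) hb1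
    have aux : ∀ d : ℕ, ∀ w : List (Fin n), n0 ≤ w.length + d →
        f '' Set.range (Phi φ i) ⊆ Set.range (Phi ψ w) →
        ∃ v, f '' Set.range (Phi φ i) ⊆ Set.range (Phi ψ (w ++ v)) ∧
          W τ (w ++ v) ≤ C * DX / δ * W ρ i := by
      intro d
      induction d with
      | zero =>
        intro w hw hs
        exfalso
        have h1 := hlow i w hs
        have h2 := W_le_pow hY.pos hb w
        have h3 : b ^ w.length ≤ b ^ n0 := pow_le_pow_of_le_one hb0.le hb1.le (by simpa using hw)
        rw [lt_div_iff₀ hC2] at hn0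
        have h4 := mul_le_mul_of_nonneg_left (h2.trans h3) hC2.le
        linarith
      | succ d ih =>
        intro w hw hs
        by_cases hk : ∃ k, f '' Set.range (Phi φ i) ⊆ Set.range (Phi ψ (w ++ [k]))
        · obtain ⟨k, hk⟩ := hk
          obtain ⟨v, hv, hv'⟩ := ih (w ++ [k]) (by simp; omega) hk
          exact ⟨k :: v, by simpa using hv, by simpa using hv'⟩
        · push Not at hk
          refine ⟨[], by simpa using hs, ?_⟩
          rw [List.append_nil]
          obtain ⟨y0, hy0⟩ := hs ⟨_, ⟨a0, rfl⟩, rfl⟩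
          obtain ⟨k, z, rfl⟩ := hY.srj y0
          obtain ⟨_, ⟨_, ⟨x1, rfl⟩, rfl⟩, hx1⟩ := Set.not_subset.1 (hk k)
          obtain ⟨y1, hy1⟩ := hs ⟨_, ⟨x1, rfl⟩, rfl⟩
          obtain ⟨k', z', rfl⟩ := hY.srj y1
          have hne : k ≠ k' := by
            rintro rfl
            exact hx1 ⟨z', by rw [← hy1, Phi_append]; rfl⟩
          have h1 := (hf (Phi φ i a0) (Phi φ i x1)).2
          rw [← hy0, ← hy1, hX.dist_Phi, hY.dist_Phi] at h1
          have h2 := mul_le_mul_of_nonneg_left (hsep k k' hne z z') (hWY w).le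
          have h3 := mul_le_mul_of_nonneg_left
            (mul_le_mul_of_nonneg_left (hDX a0 x1) (hWX i).le) hC.le
          rw [div_mul_eq_mul_div, le_div_iff₀ hδ]
          linarith
    intro w
    exact aux n0 w (by omega)
  · intro i w hw k hk
    by_contra! hcon
    obtain ⟨hcon1, hcon2⟩ := hcon
    obtain ⟨_, ⟨y0, rfl⟩, hy0⟩ := Set.not_subset.1 hcon1
    obtain ⟨_, ⟨y1, rfl⟩, ⟨_, ⟨x1, rfl⟩, hx1⟩⟩ := Set.not_disjoint_iff.1 hcon2
    obtain ⟨x0, hx0⟩ := f.surjective (Phi ψ (w ++ k) y0)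
    have hx0' : x0 ∉ Set.range (Phi φ i) := fun h => hy0 ⟨x0, h, hx0⟩
    have h1 := hX.sep_word hε hsepX i x1 x0 hx0'
    have h2 := (hf (Phi φ i x1) x0).1
    rw [hx1, hx0, hY.dist_Phi, W_append] at h2
    have h3 := mul_le_mul_of_nonneg_left h1 (inv_pos.2 hC).le
    have h4 := W_le_pow hY.pos hb k
    rw [hk] at h4
    have h5 : W τ k * DY < C⁻¹ * ε / (C * DX / δ) := by
      rw [← lt_div_iff₀ hDY0]; exact h4.trans_lt hN
    have h6 : W τ w * W τ k * dist y1 y0 ≤ W τ w * (W τ k * DY) := by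
      rw [mul_assoc]
      exact mul_le_mul_of_nonneg_left (mul_le_mul_of_nonneg_left (hDY _ _) (hWY k).le) (hWY w).le
    have h7 := mul_lt_mul_of_pos_left h5 (hWY w)
    have h8 : W τ w * (C⁻¹ * ε / (C * DX / δ)) ≤ C⁻¹ * (ε * W ρ i) := by
      calc _ ≤ (C * DX / δ * W ρ i) * (C⁻¹ * ε / (C * DX / δ)) :=
            mul_le_mul_of_nonneg_right hw (by positivity)
        _ = _ := by field_simp
    linarith

lemma key (hm : 2 ≤ m) (hn : 2 ≤ n) (hX : Dust ρ φ) (hY : Dust τ ψ) (f : X ≃ Y) (C : ℝ) (hC : 0 < C)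
    (hf : ∀ x y, C⁻¹ * dist x y ≤ dist (f x) (f y) ∧ dist (f x) (f y) ≤ C * dist x y)
    (a : Fin m) : ∃ p : ℕ, 0 < p ∧ ∃ v : List (Fin n), ρ a ^ p = W τ v := by
  classical
  obtain ⟨C1, hC1, C2, hC2, N, hext, hlow, hsat⟩ := geom hm hX hY f C hC hf
  obtain ⟨t, ht, hq1⟩ := exists_exponent hn τ hY.pos hY.lt1
  obtain ⟨q, hqd⟩ : ∃ q : Fin n → ℝ, q = fun j => τ j ^ t := ⟨_, rfl⟩
  obtain ⟨r, hrd⟩ : ∃ r : Fin m → ℝ, r = fun j => ρ j ^ t := ⟨_, rfl⟩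
  have hq : ∀ j, 0 < q j := fun j => by rw [hqd]; exact Real.rpow_pos_of_pos (hY.pos j) t
  have hr : ∀ j, 0 < r j := fun j => by rw [hrd]; exact Real.rpow_pos_of_pos (hX.pos j) t
  have hq1' : ∀ j, q j ≤ 1 := fun j => by
    rw [hqd]; exact Real.rpow_le_one (hY.pos j).le (hY.lt1 j).le ht.le
  have hr1' : ∀ j, r j ≤ 1 := fun j => by
    rw [hrd]; exact Real.rpow_le_one (hX.pos j).le (hX.lt1 j).le ht.le
  have hWq : ∀ w, W q w = (W τ w) ^ t := fun w => by rw [hqd, W_rpow hY.pos]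
  have hWr : ∀ w, W r w = (W ρ w) ^ t := fun w => by rw [hrd, W_rpow hX.pos]
  have hWX := W_pos hX.pos
  have hWY := W_pos hY.pos
  have hWrp := W_pos hr
  have hWqp := W_pos hq
  obtain ⟨ν, hν0, hadd, hcyl⟩ := exists_content q hq (by rw [hqd]; exact hq1) ψ hY.inj hY.dsj
  have hmono : ∀ A B, A ⊆ B → ν A ≤ ν B := by
    intro A B hAB
    have := hadd A (B \ A) Set.disjoint_sdiff_right
    rw [Set.union_sdiff_cancel hAB] at this
    linarith [hν0 (B \ A)]
  obtain ⟨S, hS⟩ : ∃ S : List (Fin m) → Set Y, S = fun i => f '' Set.range (Phi φ i) := ⟨_, rfl⟩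
  have hSe : ∀ i, f '' Set.range (Phi φ i) = S i := fun i => by rw [hS]
  simp only [hSe] at hext hlow hsat
  -- the finite code
  obtain ⟨K, hK⟩ : ∃ K : List (Fin m) → List (Fin n) → Finset (List.Vector (Fin n) N),
    K = fun i w => Finset.univ.filter (fun k => Set.range (Phi ψ (w ++ k.1)) ⊆ S i) := ⟨_, rfl⟩
  have hSK : ∀ i w, S i ⊆ Set.range (Phi ψ w) → W τ w ≤ C1 * W ρ i →
      S i = ⋃ k ∈ K i w, Set.range (Phi ψ (w ++ k.1)) := by
    intro i w hs hb
    apply Set.Subset.antisymm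
    · intro y hy
      obtain ⟨z, rfl⟩ := hs hy
      obtain ⟨k, hk, u, rfl⟩ := hY.exists_word N z
      have hmem : Phi ψ w (Phi ψ k u) ∈ Set.range (Phi ψ (w ++ k)) := ⟨u, Phi_append _ _ _ _⟩
      simp only [Set.mem_iUnion]
      refine ⟨⟨k, hk⟩, ?_, hmem⟩
      rw [hK]
      refine Finset.mem_filter.2 ⟨Finset.mem_univ _, ?_⟩
      rcases hsat i w hb k hk with h | h
      · exact h
      · exact (Set.disjoint_left.1 h hmem hy).elim
    · simp only [Set.iUnion_subset_iff]
      intro k hk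
      rw [hK] at hk
      simpa using hk
  have hGK : ∀ i w, S i ⊆ Set.range (Phi ψ w) → W τ w ≤ C1 * W ρ i →
      ν (S i) = W q w * ∑ k ∈ K i w, W q k.1 := by
    intro i w hs hb
    rw [hSK i w hs hb, content_biUnion hadd, Finset.mul_sum]
    · exact Finset.sum_congr rfl fun k _ => by rw [hcyl, W_append]
    · intro k _ k' _ hne
      rw [Set.disjoint_left]
      rintro _ ⟨u, rfl⟩ ⟨u', hu'⟩
      rw [Phi_append, Phi_append] at hu'
      exact hne (Subtype.ext (hY.word_unique _ _ (k.2.trans k'.2.symm) _ _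
        (hY.inj_Phi w hu').symm))
  have hSne : ∀ i, (S i).Nonempty := fun i => by
    rw [hS]
    exact (Set.range_nonempty _).image _
  have hSnil : S [] = Set.univ := by
    rw [hS]
    apply Set.eq_univ_of_forall
    intro y
    exact ⟨f.symm y, ⟨f.symm y, rfl⟩, by simp⟩
  have hnil : ∀ i, S i ⊆ Set.range (Phi ψ []) := fun i y _ => ⟨y, rfl⟩
  have hSsub : ∀ i k, S (i ++ k) ⊆ S i := by
    intro i k
    rw [hS]
    rintro _ ⟨_, ⟨x, rfl⟩, rfl⟩
    exact ⟨_, ⟨Phi φ k x, rfl⟩, by rw [Phi_append]⟩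
  have hup : ∀ i, ν (S i) ≤ C1 ^ t * W r i := by
    intro i
    obtain ⟨v, hv, hb⟩ := hext i [] (hnil i)
    calc ν (S i) ≤ W q ([] ++ v) := by rw [← hcyl]; exact hmono _ _ hv
      _ = (W τ ([] ++ v)) ^ t := hWq _
      _ ≤ (C1 * W ρ i) ^ t := Real.rpow_le_rpow (hWY _).le hb ht.le
      _ = _ := by rw [Real.mul_rpow hC1.le (hWX i).le, hWr]
  obtain ⟨b, hb0, hbq⟩ := exists_min' hq
  have hdown : ∀ i, (b ^ N / C2 ^ t) * W r i ≤ ν (S i) := by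
    intro i
    obtain ⟨v, hv, hb⟩ := hext i [] (hnil i)
    have h1 := hSK i _ hv hb
    obtain ⟨y, hy⟩ := hSne i
    have hy' := hy
    rw [h1] at hy'
    simp only [Set.mem_iUnion] at hy'
    obtain ⟨k, hk, -⟩ := hy'
    rw [hGK i _ hv hb]
    have h2 : b ^ N ≤ ∑ k ∈ K i ([] ++ v), W q k.1 :=
      calc b ^ N ≤ W q k.1 := by
            have := pow_le_W hb0.le hbq k.1
            rwa [k.2] at this
        _ ≤ _ := Finset.single_le_sum (f := fun k : List.Vector (Fin n) N => W q k.1)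
            (fun k _ => (hWqp k.1).le) hk
    have h3 : W r i ≤ C2 ^ t * W q ([] ++ v) := by
      rw [hWr, hWq, ← Real.mul_rpow hC2.le (hWY _).le]
      exact Real.rpow_le_rpow (hWX i).le (hlow i _ hv) ht.le
    have hC2t : 0 < C2 ^ t := Real.rpow_pos_of_pos hC2 t
    calc _ = b ^ N * (W r i / C2 ^ t) := by ring
      _ ≤ b ^ N * W q ([] ++ v) := by
          refine mul_le_mul_of_nonneg_left ?_ (by positivity)
          rw [div_le_iff₀ hC2t]; linarith
      _ ≤ (∑ k ∈ K i ([] ++ v), W q k.1) * W q ([] ++ v) :=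
          mul_le_mul_of_nonneg_right h2 (hWqp _).le
      _ = _ := mul_comm _ _
  have hsplit : ∀ i, ν (S i) = ∑ k, ν (S (i ++ [k])) := by
    intro i
    rw [← content_biUnion hadd]
    · congr 1
      apply Set.Subset.antisymm
      · rw [hS]
        rintro _ ⟨_, ⟨x, rfl⟩, rfl⟩
        obtain ⟨k, z, rfl⟩ := hX.srj x
        simp only [Set.mem_iUnion]
        exact ⟨k, Finset.mem_univ k, _, ⟨z, rfl⟩, by rw [Phi_append]; rfl⟩
      · simp only [Set.iUnion_subset_iff]
        exact fun k _ => hSsub i [k]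
    · intro k _ k' _ hne
      rw [Set.disjoint_left, hS]
      rintro _ ⟨_, ⟨u, rfl⟩, rfl⟩ ⟨_, ⟨u', rfl⟩, hu'⟩
      have := f.injective hu'
      rw [Phi_append, Phi_append] at this
      exact hne (hX.dsj _ _ _ _ (hX.inj_Phi i this)).symm
  have hG1 : ν (S []) = 1 := by
    have h1 := hcyl []
    rw [W_nil] at h1
    rw [hSnil, ← h1]
    congr 1
    symm
    apply Set.eq_univ_of_forall
    intro y
    exact ⟨y, rfl⟩
  obtain ⟨c0, hc0⟩ : ∃ c, c = b ^ N / C2 ^ t := ⟨_, rfl⟩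
  obtain ⟨c1, hc1⟩ : ∃ c, c = C1 ^ t := ⟨_, rfl⟩
  rw [← hc0] at hdown
  rw [← hc1] at hup
  have hc0p : 0 < c0 := by
    rw [hc0]; exact div_pos (by positivity) (Real.rpow_pos_of_pos hC2 t)
  have hc1p : 0 < c1 := by
    rw [hc1]; exact Real.rpow_pos_of_pos hC1 t
  have hr1 : ∑ k, r k = 1 := by
    have hp : 0 ≤ ∑ k, r k := Finset.sum_nonneg fun k _ => (hr k).le
    have h1 : ∀ l : ℕ, ∀ i, ν (S i) ≤ c1 * (∑ k, r k) ^ l * W r i := by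
      intro l
      induction l with
      | zero => intro i; simpa using hup i
      | succ l ih =>
        intro i
        rw [hsplit i]
        calc _ ≤ ∑ k, c1 * (∑ k, r k) ^ l * W r (i ++ [k]) := Finset.sum_le_sum fun k _ => ih _
          _ = _ := by
            simp only [W_append, W_single]
            rw [← Finset.mul_sum, ← Finset.mul_sum]; ring
    have h2 : ∀ l : ℕ, ∀ i, c0 * (∑ k, r k) ^ l * W r i ≤ ν (S i) := by
      intro l
      induction l with
      | zero => intro i; simpa using hdown i
      | succ l ih =>
        intro i
        rw [hsplit i]
        calc _ = ∑ k, c0 * (∑ k, r k) ^ l * W r (i ++ [k]) := by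
              simp only [W_append, W_single]
              rw [← Finset.mul_sum, ← Finset.mul_sum]; ring
          _ ≤ _ := Finset.sum_le_sum fun k _ => ih _
    rcases lt_trichotomy (∑ k, r k) 1 with hlt | heq | hgt
    · exfalso
      obtain ⟨l, hl⟩ := exists_pow_lt_of_lt_one (show 0 < 1 / c1 by positivity) hlt
      have := h1 l []
      rw [hG1, W_nil, mul_one] at this
      rw [lt_div_iff₀ hc1p] at hl
      linarith
    · exact heq
    · exfalso
      obtain ⟨l, hl⟩ := pow_unbounded_of_one_lt (1 / c0) hgt
      have := h2 l []
      rw [hG1, W_nil, mul_one] at this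
      rw [div_lt_iff₀ hc0p] at hl
      linarith
  -- the supremum
  obtain ⟨M, hM⟩ : ∃ M, M = ⨆ i, ν (S i) / W r i := ⟨_, rfl⟩
  have hbdd : BddAbove (Set.range fun i => ν (S i) / W r i) := by
    refine ⟨c1, ?_⟩
    rintro _ ⟨i, rfl⟩
    exact (div_le_iff₀ (hWrp i)).2 (hup i)
  have hMle : ∀ i, ν (S i) ≤ M * W r i := by
    intro i
    rw [← div_le_iff₀ (hWrp i), hM]
    exact le_ciSup hbdd i
  have hMp : 0 < M := by
    have := hMle []
    rw [hG1, W_nil] at this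
    linarith
  have hdec : ∀ i k, M * W r (i ++ [k]) - ν (S (i ++ [k])) ≤ M * W r i - ν (S i) := by
    intro i k
    have h1 : M * W r i - ν (S i) = ∑ k, (M * W r (i ++ [k]) - ν (S (i ++ [k]))) := by
      rw [Finset.sum_sub_distrib, ← hsplit]
      simp only [W_append, W_single]
      rw [← Finset.mul_sum, ← Finset.mul_sum, hr1, mul_one]
    rw [h1]
    exact Finset.single_le_sum (f := fun k => M * W r (i ++ [k]) - ν (S (i ++ [k])))
      (fun k _ => by linarith [hMle (i ++ [k])]) (Finset.mem_univ k)
  have hdecl : ∀ i (l : ℕ), M * W r (i ++ List.replicate l a) - ν (S (i ++ List.replicate l a)) ≤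
      M * W r i - ν (S i) := by
    intro i l
    induction l with
    | zero => simp
    | succ l ih =>
      rw [List.replicate_succ', ← List.append_assoc]
      exact (hdec _ a).trans ih
  -- pigeonhole
  obtain ⟨L, hL⟩ : ∃ L, L = Fintype.card (Finset (List.Vector (Fin n) N)) := ⟨_, rfl⟩
  obtain ⟨β, hβ0, hβ1, hβ⟩ := exists_max hY.lt1
  obtain ⟨V, hV⟩ := exists_pow_lt_of_lt_one
    (show 0 < ρ a ^ L / (C1 * C2) from div_pos (pow_pos (hX.pos a) _) (by positivity)) hβ1
  have hpig : ∀ i, ∃ l l' : ℕ, ∃ v : List (Fin n), l < l' ∧ l' ≤ L ∧ v.length < V ∧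
      ν (S (i ++ List.replicate l' a)) = W q v * ν (S (i ++ List.replicate l a)) := by
    intro i
    have hext' : ∀ (i : List (Fin m)) (w : List (Fin n)), ∃ w', S i ⊆ Set.range (Phi ψ w) →
        (S i ⊆ Set.range (Phi ψ w') ∧ W τ w' ≤ C1 * W ρ i ∧ w <+: w') := by
      intro i w
      by_cases hs : S i ⊆ Set.range (Phi ψ w)
      · obtain ⟨v, h1, h2⟩ := hext i w hs
        exact ⟨w ++ v, fun _ => ⟨h1, h2, List.prefix_append _ _⟩⟩
      · exact ⟨[], fun h => (hs h).elim⟩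
    choose nx hnx using hext'
    let w : ℕ → List (Fin n) := fun l =>
      Nat.rec (nx i []) (fun l u => nx (i ++ List.replicate (l + 1) a) u) l
    have hstep : ∀ l, S (i ++ List.replicate (l + 1) a) ⊆ S (i ++ List.replicate l a) := by
      intro l
      rw [List.replicate_succ', ← List.append_assoc]
      exact hSsub _ _
    have hw : ∀ l, S (i ++ List.replicate l a) ⊆ Set.range (Phi ψ (w l)) ∧
        W τ (w l) ≤ C1 * W ρ (i ++ List.replicate l a) := by
      intro l
      induction l with
      | zero =>
        have := hnx i [] (hnil i)
        simpa using ⟨this.1, this.2.1⟩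
      | succ l ih =>
        have := hnx (i ++ List.replicate (l + 1) a) (w l) ((hstep l).trans ih.1)
        exact ⟨this.1, this.2.1⟩
    have hpre1 : ∀ l, w l <+: w (l + 1) := fun l =>
      (hnx (i ++ List.replicate (l + 1) a) (w l) ((hstep l).trans (hw l).1)).2.2
    have hpre : ∀ l l', l ≤ l' → w l <+: w l' := by
      intro l l' h
      induction l', h using Nat.le_induction with
      | base => exact List.prefix_refl _
      | succ k _ ih => exact ih.trans (hpre1 k)
    obtain ⟨x, y, hxy, hKe⟩ := Fintype.exists_ne_map_eq_of_card_lt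
      (fun l : Fin (L + 1) => K (i ++ List.replicate l.1 a) (w l.1)) (by simp [hL])
    wlog hlt : x.1 < y.1 generalizing x y
    · exact this y x hxy.symm hKe.symm
        (lt_of_le_of_ne (not_lt.1 hlt) (fun h => hxy (Fin.ext h.symm)))
    obtain ⟨v, hv⟩ := hpre x.1 y.1 hlt.le
    have hyL : y.1 ≤ L := by omega
    refine ⟨x.1, y.1, v, hlt, hyL, ?_, ?_⟩
    · by_contra! hcon
      have h1 := hlow _ _ (hw y.1).1
      have h2 := (hw x.1).2
      rw [← hv, W_append, W_append, W_replicate] at h1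
      rw [W_append, W_replicate] at h2
      have h3 : W τ v ≤ β ^ V := (W_le_pow hY.pos hβ v).trans
        (pow_le_pow_of_le_one hβ0.le hβ1.le hcon)
      have h4 : W τ v < ρ a ^ L / (C1 * C2) := h3.trans_lt hV
      rw [lt_div_iff₀ (by positivity)] at h4
      have h5 : ρ a ^ L ≤ ρ a ^ y.1 := pow_le_pow_of_le_one (hX.pos a).le (hX.lt1 a).le hyL
      have h6 : ρ a ^ x.1 ≤ 1 := pow_le_one₀ (hX.pos a).le (hX.lt1 a).le
      have h7 : W ρ i * ρ a ^ y.1 ≤ C2 * (C1 * W ρ i * W τ v) := by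
        refine h1.trans (mul_le_mul_of_nonneg_left ?_ hC2.le)
        refine mul_le_mul_of_nonneg_right (h2.trans ?_) (hWY v).le
        exact mul_le_mul_of_nonneg_left (mul_le_of_le_one_right (hWX i).le h6) hC1.le
      have h8 := mul_lt_mul_of_pos_left (h4.trans_le h5) (hWX i)
      linarith
    · rw [hGK _ _ (hw y.1).1 (hw y.1).2, hGK _ _ (hw x.1).1 (hw x.1).2]
      have : K (i ++ List.replicate x.1 a) (w x.1) = K (i ++ List.replicate y.1 a) (w y.1) := hKe
      rw [this, ← hv, W_append]
      ring
  -- finiteness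
  have hfin : ∃ l l' : ℕ, ∃ v : List (Fin n), l < l' ∧ W q v * r a ^ l = r a ^ l' := by
    by_contra! hno
    let Z : Set (ℕ × ℕ × List (Fin n)) :=
      {z | z.1 < z.2.1 ∧ z.2.1 ≤ L ∧ z.2.2.length < V}
    have hZ : Z.Finite := by
      refine ((Set.finite_le_nat L).prod ((Set.finite_le_nat L).prod
        (List.finite_length_lt (Fin n) V))).subset ?_
      rintro ⟨l, l', v⟩ ⟨h1, h2, h3⟩
      simp only at h1 h2 h3
      exact ⟨by simp; omega, by simpa using h2, h3⟩
    have hη : ∃ η > 0, ∀ z ∈ Z, η ≤ |W q z.2.2 * r a ^ z.1 - r a ^ z.2.1| := by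
      rcases Z.eq_empty_or_nonempty with he | hne
      · exact ⟨1, one_pos, by simp [he]⟩
      · obtain ⟨z, hz, hz'⟩ := hZ.exists_minimalFor
          (fun z => |W q z.2.2 * r a ^ z.1 - r a ^ z.2.1|) Z hne
        refine ⟨_, abs_pos.2 (sub_ne_zero.2 (hno z.1 z.2.1 z.2.2 hz.1)), fun z1 hz1 => ?_⟩
        rcases le_total |W q z.2.2 * r a ^ z.1 - r a ^ z.2.1|
          |W q z1.2.2 * r a ^ z1.1 - r a ^ z1.2.1| with h | h
        · exact h
        · exact hz' hz1 h
    obtain ⟨η, hη0, hη⟩ := hη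
    obtain ⟨i, hi⟩ : ∃ i, M - M * η / 2 < ν (S i) / W r i := by
      apply exists_lt_of_lt_ciSup
      rw [← hM]
      have : 0 < M * η := by positivity
      linarith
    rw [lt_div_iff₀ (hWrp i)] at hi
    obtain ⟨l, l', v, h1, h2, h3, h4⟩ := hpig i
    have h5 := hη (l, l', v) ⟨h1, h2, h3⟩
    simp only at h5
    have h6 := hdecl i l
    have h7 := hdecl i l'
    have h8 := hMle (i ++ List.replicate l a)
    have h9 := hMle (i ++ List.replicate l' a)
    rw [h4] at h7 h9
    rw [W_append, W_replicate] at h6 h7 h8 h9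
    have hv0 := hWqp v
    have hv1 := W_le_one hq hq1' v
    have hri := hWrp i
    generalize ν (S (i ++ List.replicate l a)) = g at *
    generalize r a ^ l = A at *
    generalize r a ^ l' = B at *
    generalize W q v = u at *
    generalize W r i = R at *
    generalize ν (S i) = g0 at *
    have e1 : u * (M * (R * A) - g) ≤ M * (R * A) - g :=
      mul_le_of_le_one_left (by linarith) hv1
    have e2 : 0 ≤ u * (M * (R * A) - g) := mul_nonneg hv0.le (by linarith)
    have hMR : 0 < M * R := by positivity
    have e3 : M * R * |u * A - B| ≤ M * R * (η / 2) := by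
      rw [← abs_of_pos hMR, ← abs_mul, abs_of_pos hMR, abs_le]
      constructor <;> nlinarith
    have e4 := le_of_mul_le_mul_left e3 hMR
    linarith
  obtain ⟨l, l', v, hll, he⟩ := hfin
  refine ⟨l' - l, by omega, v, ?_⟩
  have hra := hr a
  have h1 : W q v = r a ^ (l' - l) := by
    have h2 : r a ^ l' = r a ^ (l' - l) * r a ^ l := by
      rw [← pow_add]; congr 1; omega
    rw [h2] at he
    exact mul_right_cancel₀ (pow_pos hra l).ne' he
  rw [hWq, hrd] at h1
  simp only at h1
  rw [← Real.rpow_natCast, ← Real.rpow_mul (hX.pos a).le, mul_comm, Real.rpow_mul (hX.pos a).le,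
    Real.rpow_natCast] at h1
  exact ((Real.rpow_left_inj (hWY v).le (pow_pos (hX.pos a) _).le ht.ne').1 h1).symm

end main

lemma sgp_mul {m : ℕ} {τ : Fin m → ℝ} {x y : ℝ} (hx : x ∈ sgp τ) (hy : y ∈ sgp τ) :
    x * y ∈ sgp τ := by
  obtain ⟨a, ha, rfl⟩ := hx
  obtain ⟨b, hb, rfl⟩ := hy
  refine ⟨fun i => a i + b i, ?_, ?_⟩
  · rw [Finset.sum_add_distrib]; omega
  · rw [← Finset.prod_mul_distrib]
    exact Finset.prod_congr rfl fun i _ => (pow_add _ _ _).symm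

lemma sgp_gen {m : ℕ} (τ : Fin m → ℝ) (j : Fin m) : τ j ∈ sgp τ := by
  refine ⟨Pi.single j 1, ?_, ?_⟩
  · simp
  · rw [Finset.prod_eq_single j]
    · simp
    · intro b _ hb; simp [Pi.single_eq_of_ne hb]
    · simp

lemma sgp_W {m : ℕ} (τ : Fin m → ℝ) (w : List (Fin m)) (hw : w ≠ []) : W τ w ∈ sgp τ := by
  induction w with
  | nil => exact (hw rfl).elim
  | cons j w ih =>
    by_cases h : w = []
    · subst h; rw [W_single]; exact sgp_gen τ j
    · rw [W_cons]; exact sgp_mul (sgp_gen τ j) (ih h)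

lemma sgp_pow {m : ℕ} {τ : Fin m → ℝ} {x : ℝ} (hx : x ∈ sgp τ) (k : ℕ) (hk : 0 < k) :
    x ^ k ∈ sgp τ := by
  induction k, hk using Nat.le_induction with
  | base => simpa using hx
  | succ k _ ih => rw [pow_succ]; exact sgp_mul ih hx

lemma sgp_le {m n : ℕ} {σ : Fin m → ℝ} {τ : Fin n → ℝ} (h : ∀ j, σ j ∈ sgp τ) : sgp σ ⊆ sgp τ := by
  classical
  rintro _ ⟨a, ha, rfl⟩
  have key : ∀ s : Finset (Fin m), (∑ i ∈ s, a i = 0 ∧ ∏ i ∈ s, σ i ^ a i = 1) ∨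
      ∏ i ∈ s, σ i ^ a i ∈ sgp τ := by
    intro s
    induction s using Finset.induction_on with
    | empty => left; simp
    | insert j s hj ih =>
      rw [Finset.sum_insert hj, Finset.prod_insert hj]
      rcases Nat.eq_zero_or_pos (a j) with h0 | h0
      · simpa [h0] using ih
      · right
        have := sgp_pow (h j) (a j) h0
        rcases ih with ih | ih
        · rw [ih.2, mul_one]; exact this
        · exact sgp_mul this ih
  rcases key Finset.univ with h0 | h0
  · omega
  · exact h0

lemma half {m n : ℕ} {ρ : Fin m → ℝ} {τ : Fin n → ℝ} (hρ : ∀ j, 0 < ρ j) (hρ1 : ∀ j, ρ j < 1)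
    (h : ∀ a, ∃ p : ℕ, 0 < p ∧ ∃ v : List (Fin n), ρ a ^ p = W τ v) :
    ∃ p : ℕ, 0 < p ∧ sgp (fun i => ρ i ^ p) ⊆ sgp τ := by
  choose p hp v hv using h
  refine ⟨∏ a, p a, Finset.prod_pos fun a _ => hp a, sgp_le fun j => ?_⟩
  have h1 : ρ j ^ p j ∈ sgp τ := by
    rw [hv]
    apply sgp_W
    intro h0
    have h2 := hv j
    rw [h0, W_nil] at h2
    have := pow_lt_one₀ (hρ j).le (hρ1 j) (hp j).ne'
    linarith
  obtain ⟨k, hk⟩ := Finset.dvd_prod_of_mem p (Finset.mem_univ j)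
  have hpos : 0 < ∏ a, p a := Finset.prod_pos fun a _ => hp a
  rw [hk, pow_mul]
  refine sgp_pow h1 k (Nat.pos_of_ne_zero ?_)
  rintro rfl
  omega

lemma dust_of {d m : ℕ} {ρ : Fin m → ℝ} {E : Set (EuclideanSpace ℝ (Fin d))}
    (h : IsDustLike E ρ) : CompactSpace E ∧ Nonempty E ∧ ∃ φ : Fin m → E → E, Dust ρ φ := by
  obtain ⟨hc, hne, hρ, φ, hd, hE, hdis⟩ := h
  have hmap : ∀ j, ∀ x ∈ E, φ j x ∈ E := by
    intro j x hx
    rw [hE]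
    exact Set.mem_iUnion.2 ⟨j, x, hx, rfl⟩
  refine ⟨isCompact_iff_compactSpace.1 hc, hne.to_subtype,
    fun j x => ⟨φ j x.1, hmap j x.1 x.2⟩, ?_⟩
  refine ⟨fun j => (hρ j).1, fun j => (hρ j).2, fun j x y => hd j x y, ?_, ?_⟩
  · rintro ⟨x, hx⟩
    have hx' := hx
    rw [hE] at hx'
    obtain ⟨j, y, hy, rfl⟩ := Set.mem_iUnion.1 hx'
    exact ⟨j, ⟨y, hy⟩, rfl⟩
  · intro j k x y hxy
    by_contra hne
    have h1 : φ j x.1 = φ k y.1 := congrArg Subtype.val hxy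
    exact Set.disjoint_left.1 (hdis hne) ⟨x.1, x.2, rfl⟩ ⟨y.1, y.2, h1.symm⟩

end FM

theorem stmt0 {d d' m n : ℕ} (hm : 2 ≤ m) (hn : 2 ≤ n)
    (ρ : Fin m → ℝ) (τ : Fin n → ℝ)
    (E : Set (EuclideanSpace ℝ (Fin d))) (F : Set (EuclideanSpace ℝ (Fin d')))
    (hE : IsDustLike E ρ) (hF : IsDustLike F τ) (h : LipEquiv E F) :
    ∃ p q : ℕ, 0 < p ∧ 0 < q ∧
      sgp (fun i => ρ i ^ p) ⊆ sgp τ ∧ sgp (fun k => τ k ^ q) ⊆ sgp ρ := by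
  obtain ⟨_, _, φ, hφ⟩ := FM.dust_of hE
  obtain ⟨_, _, ψ, hψ⟩ := FM.dust_of hF
  obtain ⟨f, hbij, C, hC, hf⟩ := h
  let e : E ≃ F := Equiv.ofBijective f hbij
  have h1 : ∀ x y, C⁻¹ * dist x y ≤ dist (e x) (e y) ∧ dist (e x) (e y) ≤ C * dist x y :=
    fun x y => hf x y
  have h2 : ∀ x y, C⁻¹ * dist x y ≤ dist (e.symm x) (e.symm y) ∧
      dist (e.symm x) (e.symm y) ≤ C * dist x y := by
    intro x y
    have := h1 (e.symm x) (e.symm y)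
    rw [e.apply_symm_apply, e.apply_symm_apply] at this
    constructor
    · rw [inv_mul_le_iff₀ hC]; exact this.2
    · rw [← inv_mul_le_iff₀ hC]; exact this.1
  obtain ⟨p, hp, hp'⟩ := FM.half hφ.pos hφ.lt1 (FM.key hm hn hφ hψ e C hC h1)
  obtain ⟨q, hq, hq'⟩ := FM.half hψ.pos hψ.lt1 (FM.key hn hm hψ hφ e.symm C hC h2)
  exact ⟨p, q, hp, hq, hp', hq'⟩
end
end

section
/- Let E ⊆ ℝ^d and F ⊆ ℝ^{d'} be dust-like self-similar sets with contraction vectors ρ = (ρ_1,…,ρ_m) and τ = (τ_1,…,τ_n) respectively, where m, n ≥ 2. If E and F are Lipschitz equivalent, then there exists δ > 0 such that ρ_1^δ + ⋯ + ρ_m^δ = 1, τ_1^δ + ⋯ + τ_n^δ = 1, and ℚ(ρ_1^δ,…,ρ_m^δ) = ℚ(τ_1^δ,…,τ_n^δ). -/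
open scoped BigOperators

noncomputable section

structure DS (X : Type) [MetricSpace X] (m : ℕ) (ρ : Fin m → ℝ) where
  φ : Fin m → X → X
  sim : ∀ j x y, dist (φ j x) (φ j y) = ρ j * dist x y
  cover : ∀ x, ∃ j y, φ j y = x
  D : ℝ
  hD : 0 < D
  bdd : ∀ x y : X, dist x y ≤ D
  c : ℝ
  hc : 0 < c
  sep : ∀ j k x y, j ≠ k → c ≤ dist (φ j x) (φ k y)
  θ : ℝ
  hθ1 : θ < 1
  hθ : ∀ j, ρ j ≤ θ
  hθ0 : 0 < θ
  β : ℝ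
  hβ : 0 < β
  hβρ : ∀ j, β ≤ ρ j
  x0 : X

namespace DS

def R {m : ℕ} (ρ : Fin m → ℝ) (w : List (Fin m)) : ℝ := (w.map ρ).prod

lemma R_nil {m : ℕ} (ρ : Fin m → ℝ) : R ρ [] = 1 := by simp [R]
lemma R_cons {m : ℕ} (ρ : Fin m → ℝ) (k) (w) : R ρ (k :: w) = ρ k * R ρ w := by simp [R]
lemma R_append {m : ℕ} (ρ : Fin m → ℝ) (u w) : R ρ (u ++ w) = R ρ u * R ρ w := by simp [R]
lemma R_pos {m : ℕ} {ρ : Fin m → ℝ} (h : ∀ j, 0 < ρ j) (w) : 0 < R ρ w := by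
  induction w with
  | nil => simp [R_nil]
  | cons k w ih => rw [R_cons]; exact mul_pos (h k) ih

lemma R_rpow {m : ℕ} {ρ : Fin m → ℝ} (h : ∀ j, 0 < ρ j) (s : ℝ) (w) :
    R ρ w ^ s = R (fun k => ρ k ^ s) w := by
  induction w with
  | nil => simp [R_nil]
  | cons k w ih =>
    rw [R_cons, R_cons, Real.mul_rpow (h k).le (R_pos h w).le, ih]

variable {X Y : Type} [MetricSpace X] [MetricSpace Y] {m n : ℕ} {ρ : Fin m → ℝ} {τ : Fin n → ℝ}

lemma pos (S : DS X m ρ) (j) : 0 < ρ j := S.hβ.trans_le (S.hβρ j)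

lemma Rpos (S : DS X m ρ) (w) : 0 < R ρ w := R_pos S.pos w

lemma R_le (S : DS X m ρ) (w) : R ρ w ≤ S.θ ^ w.length := by
  induction w with
  | nil => simp [R_nil]
  | cons k w ih =>
    rw [R_cons, List.length_cons, pow_succ']
    exact mul_le_mul (S.hθ k) ih (S.Rpos w).le S.hθ0.le

def Φ (S : DS X m ρ) : List (Fin m) → X → X
  | [] => id
  | k :: w => S.Φ w ∘ S.φ k

def C (S : DS X m ρ) (w : List (Fin m)) : Set X := Set.range (S.Φ w)

lemma Φ_append (S : DS X m ρ) (u w) : S.Φ (u ++ w) = S.Φ w ∘ S.Φ u := by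
  induction u with
  | nil => simp [Φ]
  | cons k u ih => simp [Φ, ih, Function.comp_assoc]

lemma Φ_dist (S : DS X m ρ) (w) (x y) : dist (S.Φ w x) (S.Φ w y) = R ρ w * dist x y := by
  induction w generalizing x y with
  | nil => simp [Φ, R_nil]
  | cons k w ih => simp only [Φ, Function.comp_apply, ih, S.sim, R_cons]; ring

lemma Φ_inj (S : DS X m ρ) (w) : Function.Injective (S.Φ w) := by
  intro x y h
  have := S.Φ_dist w x y
  rw [h, dist_self] at this
  have h2 := S.Rpos w
  exact dist_eq_zero.1 ((mul_eq_zero.1 this.symm).resolve_left h2.ne')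

lemma φ_eq (S : DS X m ρ) {j k x y} (h : S.φ j x = S.φ k y) : j = k := by
  by_contra hne
  have := S.sep j k x y hne
  rw [h, dist_self] at this
  linarith [S.hc]

lemma φ_inj (S : DS X m ρ) {k x y} (h : S.φ k x = S.φ k y) : x = y := by
  have := S.Φ_inj [k] (a₁ := x) (a₂ := y)
  simp only [Φ, Function.comp_apply, id] at this
  exact this h

lemma C_nil (S : DS X m ρ) : S.C [] = Set.univ := by simp [C, Φ]

lemma C_diam (S : DS X m ρ) {w x y} (hx : x ∈ S.C w) (hy : y ∈ S.C w) :
    dist x y ≤ R ρ w * S.D := by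
  obtain ⟨a, rfl⟩ := hx
  obtain ⟨b, rfl⟩ := hy
  rw [S.Φ_dist]
  exact mul_le_mul_of_nonneg_left (S.bdd a b) (S.Rpos w).le

lemma C_cons_sub (S : DS X m ρ) (k w) : S.C (k :: w) ⊆ S.C w := by
  rintro _ ⟨a, rfl⟩
  exact ⟨S.φ k a, rfl⟩

lemma C_cover (S : DS X m ρ) {w x} (hx : x ∈ S.C w) : ∃ k, x ∈ S.C (k :: w) := by
  obtain ⟨a, rfl⟩ := hx
  obtain ⟨k, b, rfl⟩ := S.cover a
  exact ⟨k, b, rfl⟩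

lemma C_eq (S : DS X m ρ) (w) : S.C w = ⋃ k, S.C (k :: w) := by
  ext x
  simp only [Set.mem_iUnion]
  exact ⟨S.C_cover, fun ⟨k, h⟩ => S.C_cons_sub k w h⟩

lemma C_disj (S : DS X m ρ) (w) : Pairwise (Function.onFun Disjoint fun k => S.C (k :: w)) := by
  intro j k hjk
  refine Set.disjoint_left.2 ?_
  rintro _ ⟨a, rfl⟩ ⟨b, hb⟩
  exact hjk (S.φ_eq (S.Φ_inj w hb)).symm

lemma C_sep (S : DS X m ρ) {w x y} (hx : x ∈ S.C w) (hy : y ∉ S.C w) :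
    S.c * R ρ w ≤ dist x y := by
  induction w with
  | nil => simp [C_nil] at hy
  | cons k w ih =>
    have h1 : R ρ (k :: w) ≤ R ρ w := by
      rw [R_cons]
      have := S.hθ k
      have := S.hθ1
      nlinarith [S.Rpos w]
    by_cases hyw : y ∈ S.C w
    · obtain ⟨a, rfl⟩ := hx
      obtain ⟨l, b, rfl⟩ := S.C_cover hyw
      have hkl : k ≠ l := by
        rintro rfl
        exact hy ⟨b, rfl⟩
      have := S.sep k l a b hkl
      simp only [Φ, Function.comp_apply, S.Φ_dist]
      nlinarith [S.Rpos w, S.hc]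
    · exact (mul_le_mul_of_nonneg_left h1 S.hc.le).trans (ih (S.C_cons_sub _ _ hx) hyw)

/-! ### the finitely additive measure -/

open Classical in
def mu (S : DS X m ρ) (q : Fin m → ℝ) : ℕ → Set X → ℝ
  | 0, A => if S.x0 ∈ A then 1 else 0
  | N + 1, A => ∑ k, q k * S.mu q N (S.φ k ⁻¹' A)

variable (S : DS X m ρ) {q : Fin m → ℝ}

lemma mu_nonneg (hq : ∀ k, 0 < q k) (N A) : 0 ≤ S.mu q N A := by
  induction N generalizing A with
  | zero => simp only [mu]; split_ifs <;> norm_num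
  | succ N ih => exact Finset.sum_nonneg fun k _ => mul_nonneg (hq k).le (ih _)

lemma mu_union (N) {A B : Set X} (h : Disjoint A B) :
    S.mu q N (A ∪ B) = S.mu q N A + S.mu q N B := by
  induction N generalizing A B with
  | zero =>
    simp only [mu, Set.mem_union]
    have : S.x0 ∈ A → S.x0 ∉ B := fun h' => Set.disjoint_left.1 h h'
    by_cases h1 : S.x0 ∈ A <;> by_cases h2 : S.x0 ∈ B <;> simp_all
  | succ N ih =>
    simp only [mu, ← Finset.sum_add_distrib, Set.preimage_union]
    refine Finset.sum_congr rfl fun k _ => ?_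
    rw [ih (h.preimage _)]; ring

lemma mu_univ (hq1 : ∑ k, q k = 1) (N) : S.mu q N Set.univ = 1 := by
  induction N with
  | zero => simp [mu]
  | succ N ih => simp [mu, ih, hq1]

lemma mu_empty (N) : S.mu q N ∅ = 0 := by
  induction N with
  | zero => simp [mu]
  | succ N ih => simp [mu, ih]

lemma mu_le (hq : ∀ k, 0 < q k) (hq1 : ∑ k, q k = 1) (N A) : S.mu q N A ≤ 1 := by
  have h := S.mu_union (q := q) N (disjoint_compl_right (a := A))
  rw [Set.union_compl_self, S.mu_univ hq1] at h
  linarith [S.mu_nonneg hq N Aᶜ]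

lemma mu_C (hq1 : ∑ k, q k = 1) (N w) (h : w.length ≤ N) : S.mu q N (S.C w) = R q w := by
  induction N generalizing w with
  | zero =>
    have : w = [] := List.length_eq_zero_iff.1 (by omega)
    subst this
    simp [C_nil, mu, R_nil]
  | succ N ih =>
    rcases List.eq_nil_or_concat w with rfl | ⟨v, i, rfl⟩
    · rw [C_nil, S.mu_univ hq1, R_nil]
    · have h1 : ∀ k, S.φ k ⁻¹' (S.C (v ++ [i])) = if k = i then S.C v else ∅ := by
        intro k
        ext x
        simp only [C, Φ_append, Φ, Set.mem_preimage, Set.mem_range, Function.comp_apply, id]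
        split_ifs with hk
        · subst hk
          simp only [Set.mem_range]
          exact ⟨fun ⟨y, hy⟩ => ⟨y, S.φ_inj hy⟩, fun ⟨y, hy⟩ => ⟨y, by rw [hy]⟩⟩
        · simp only [Set.mem_empty_iff_false, iff_false]
          rintro ⟨y, hy⟩
          exact hk (S.φ_eq hy).symm
      have h2 : v.length ≤ N := by simp at h; exact h
      simp only [List.concat_eq_append, mu, h1]
      rw [Finset.sum_eq_single i]
      · rw [if_pos rfl, ih v h2, R_append, R_cons, R_nil]; ring
      · intro k _ hk
        rw [if_neg hk, mu_empty, mul_zero]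
      · simp

lemma exists_nu (hq : ∀ k, 0 < q k) (hq1 : ∑ k, q k = 1) :
    ∃ ν : Set X → ℝ, (∀ A, 0 ≤ ν A) ∧ (∀ A B, Disjoint A B → ν (A ∪ B) = ν A + ν B) ∧
      ∀ w, ν (S.C w) = R q w := by
  have key : ∀ A, ∃ l, Filter.Tendsto (fun N => S.mu q N A) (Filter.hyperfilter ℕ) (nhds l) := by
    intro A
    obtain ⟨l, -, hl⟩ := (isCompact_Icc (a := (0:ℝ)) (b := 1)).ultrafilter_le_nhds
      ((Filter.hyperfilter ℕ).map (fun N => S.mu q N A)) (by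
        rw [Filter.le_principal_iff]
        refine Ultrafilter.mem_map.2 (Filter.univ_mem' ?_)
        exact fun N => ⟨S.mu_nonneg hq N A, S.mu_le hq hq1 N A⟩)
    exact ⟨l, hl⟩
  choose ν hν using key
  refine ⟨ν, fun A => ge_of_tendsto' (hν A) fun N => S.mu_nonneg hq N A, ?_, ?_⟩
  · intro A B h
    refine tendsto_nhds_unique (hν _) ?_
    simp only [S.mu_union _ h]
    exact (hν A).add (hν B)
  · intro w
    refine tendsto_nhds_unique (hν _) ?_
    refine tendsto_const_nhds.congr' ?_
    have : ∀ᶠ N in Filter.atTop, R q w = S.mu q N (S.C w) := by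
      filter_upwards [Filter.eventually_ge_atTop w.length] with N hN
      rw [S.mu_C hq1 N w hN]
    exact Nat.hyperfilter_le_atTop this

lemma nu_iUnion {ν : Set X → ℝ} (hadd : ∀ A B, Disjoint A B → ν (A ∪ B) = ν A + ν B)
    {k : ℕ} (A : Fin k → Set X) (hA : Pairwise (Function.onFun Disjoint A)) :
    ν (⋃ i, A i) = ∑ i, ν (A i) := by
  have h0 : ν ∅ = 0 := by
    have := hadd ∅ ∅ (by simp)
    simp at this; exact this
  have : ∀ s : Finset (Fin k), ν (⋃ i ∈ s, A i) = ∑ i ∈ s, ν (A i) := by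
    intro s
    induction s using Finset.induction_on with
    | empty => simp [h0]
    | insert a s ha ih =>
      rw [Finset.set_biUnion_insert, Finset.sum_insert ha, hadd, ih]
      simp only [Set.disjoint_iUnion_right]
      intro i hi
      exact hA (by rintro rfl; exact ha hi)
  simpa using this Finset.univ

/-! ### finite value sets -/

def T (q : Fin m → ℝ) : ℕ → Set ℝ
  | 0 => {0, 1}
  | N + 1 => (fun t : Fin m → ℝ => ∑ k, q k * t k) '' Set.pi Set.univ (fun _ => T q N)

lemma T_fin (q : Fin m → ℝ) (N) : (T q N).Finite := by
  induction N with
  | zero => simp [T]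
  | succ N ih => exact (Set.Finite.pi fun _ => ih).image _

lemma T_field (q : Fin m → ℝ) (K : IntermediateField ℚ ℝ) (hK : ∀ k, q k ∈ K) (N) :
    ∀ t ∈ T q N, t ∈ K := by
  induction N with
  | zero =>
    rintro t (rfl | rfl)
    · exact K.zero_mem
    · exact K.one_mem
  | succ N ih =>
    rintro _ ⟨t, ht, rfl⟩
    exact sum_mem fun k _ => K.mul_mem (hK k) (ih _ (ht k trivial))

lemma R_field (q : Fin m → ℝ) (K : IntermediateField ℚ ℝ) (hK : ∀ k, q k ∈ K) (w) :
    R q w ∈ K := by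
  induction w with
  | nil => rw [R_nil]; exact K.one_mem
  | cons k w ih => rw [R_cons]; exact K.mul_mem (hK k) ih

lemma nu_T {ν : Set X → ℝ} (hadd : ∀ A B, Disjoint A B → ν (A ∪ B) = ν A + ν B)
    (hC : ∀ w, ν (S.C w) = R q w) (A : Set X) (N j)
    (h : ∀ u : List (Fin m), u.length = N → S.C (u ++ j) ⊆ A ∨ Disjoint (S.C (u ++ j)) A) :
    ∃ t ∈ T q N, ν (A ∩ S.C j) = R q j * t := by
  have h0 : ν ∅ = 0 := by
    have := hadd ∅ ∅ (by simp)
    simp at this; exact this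
  induction N generalizing j with
  | zero =>
    rcases h [] rfl with h | h
    · refine ⟨1, by simp [T], ?_⟩
      rw [Set.inter_eq_right.2 (by simpa using h), hC, mul_one]
    · refine ⟨0, by simp [T], ?_⟩
      rw [Set.disjoint_iff_inter_eq_empty.1 (by simpa using h.symm), h0, mul_zero]
  | succ N ih =>
    have h1 : ∀ k, ∃ t ∈ T q N, ν (A ∩ S.C (k :: j)) = R q (k :: j) * t := by
      intro k
      refine ih (k :: j) fun u hu => ?_
      have := h (u ++ [k]) (by simp [hu])
      simpa using this
    choose t ht htν using h1
    refine ⟨∑ k, q k * t k, ⟨t, fun k _ => ht k, rfl⟩, ?_⟩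
    rw [S.C_eq j, Set.inter_iUnion, nu_iUnion hadd, Finset.mul_sum]
    · refine Finset.sum_congr rfl fun k _ => ?_
      rw [htν, R_cons]; ring
    · intro a b hab
      exact (S.C_disj j hab).mono Set.inter_subset_right Set.inter_subset_right

/-! ### abstract maximisation -/

lemma abstract_max {p : Fin m → ℝ} (hp : ∀ k, 0 < p k) (hp1 : ∑ k, p k = 1)
    (h : List (Fin m) → ℝ) (h0 : h [] = 1) (hs : ∀ w, h w = ∑ k, h (k :: w))
    (M : ℝ) (hM : ∀ w, h w ≤ M * R p w) (T : Set ℝ) (hT : T.Finite)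
    (hr : ∀ w, ∃ a, ∃ t ∈ T, h w = a * t ∧ ∀ k, ∃ t' ∈ T, h (k :: w) = a * t') :
    ∃ w, 0 < h w ∧ ∀ k, h (k :: w) = p k * h w := by
  classical
  set g : List (Fin m) → ℝ := fun w => h w / R p w with hg
  have hbdd : BddAbove (Set.range g) := by
    refine ⟨M, ?_⟩
    rintro _ ⟨w, rfl⟩
    rw [hg]
    exact (div_le_iff₀ (R_pos hp w)).2 (hM w)
  set G := sSup (Set.range g)
  have hG : ∀ w, g w ≤ G := fun w => le_csSup hbdd ⟨w, rfl⟩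
  have hG1 : 1 ≤ G := by
    have := hG []
    simpa [hg, h0, R_nil] using this
  set Q : Set ℝ := (fun x : (ℝ × ℝ) × Fin m => x.1.1 / x.1.2 / p x.2) ''
    ((T ×ˢ T) ×ˢ Set.univ) with hQ
  have hQf : Q.Finite := ((hT.prod hT).prod Set.finite_univ).image _
  obtain ⟨b, hb1, hb⟩ : ∃ b : ℝ, 1 < b ∧ ∀ x ∈ Q, 1 < x → b ≤ x := by
    have hf : (insert 2 (Q ∩ Set.Ioi 1) : Set ℝ).Finite := (hQf.inter_of_left _).insert _
    obtain ⟨b, hbm, hb⟩ := Set.exists_min_image _ id hf ⟨2, by simp⟩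
    refine ⟨b, ?_, fun x hx hx1 => hb x (Or.inr ⟨hx, hx1⟩)⟩
    rcases hbm with rfl | hbm
    · norm_num
    · exact hbm.2
  obtain ⟨_, ⟨w, rfl⟩, hw⟩ := exists_lt_of_lt_csSup (Set.range_nonempty g)
    (show G / b < G from div_lt_self (by linarith) hb1)
  have hbG : 0 < G / b := by positivity
  have hgw : 0 < g w := hbG.trans hw
  have hRw := R_pos hp w
  have hhw : 0 < h w := by
    have : h w = g w * R p w := by simp only [hg]; field_simp
    rw [this]; positivity
  have hle : ∀ k, h (k :: w) ≤ p k * h w := by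
    intro k
    obtain ⟨a, t, ht, hat, hk⟩ := hr w
    obtain ⟨t', ht', hat'⟩ := hk k
    by_contra hcon
    push Not at hcon
    have hpk := hp k
    have ha : a ≠ 0 := by rintro rfl; simp at hat; linarith
    have ht0 : t ≠ 0 := by rintro rfl; simp at hat; linarith
    have e1 : t' / t / p k = h (k :: w) / (p k * h w) := by
      rw [hat, hat']; field_simp
    have e2 : 1 < t' / t / p k := by
      rw [e1, lt_div_iff₀ (by positivity)]; linarith
    have e3 := hb _ ⟨((t', t), k), ⟨⟨ht', ht⟩, trivial⟩, rfl⟩ e2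
    simp only [e1] at e3
    have e4 : g (k :: w) = g w * (h (k :: w) / (p k * h w)) := by
      simp only [hg, R_cons]; field_simp
    have e5 := hG (k :: w)
    rw [e4] at e5
    rw [div_lt_iff₀ (by linarith)] at hw
    have := mul_le_mul_of_nonneg_left e3 hgw.le
    linarith
  refine ⟨w, hhw, ?_⟩
  have hsum : ∑ k, h (k :: w) = ∑ k, p k * h w := by
    rw [← hs, ← Finset.sum_mul, hp1, one_mul]
  intro k
  exact (Finset.sum_eq_sum_iff_of_le fun k _ => hle k).1 hsum k (Finset.mem_univ k)

/-! ### geometry of the bi-Lipschitz map -/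

section geom
variable (S : DS X m ρ) (S' : DS Y n τ) (f : X ≃ Y) (L : ℝ) (hL : 0 < L)
  (hf1 : ∀ x y, dist x y ≤ L * dist (f x) (f y)) (hf2 : ∀ x y, dist (f x) (f y) ≤ L * dist x y)

include hL hf1 hf2 in
lemma lemA (hm : 2 ≤ m) : ∃ K, 0 < K ∧ ∀ w, ∃ j, f '' S.C w ⊆ S'.C j ∧ R τ j ≤ K * R ρ w := by
  have hD := S.hD
  have hD' := S'.hD
  have hc := S.hc
  have hc' := S'.hc
  have hβ' := S'.hβ
  refine ⟨L * S.D / (S'.c * S'.β), by positivity, fun w => ?_⟩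
  by_contra hcon
  push Not at hcon
  have hRw := S.Rpos w
  have step : ∀ N : ℕ, ∃ j : List (Fin n), j.length = N ∧ f '' S.C w ⊆ S'.C j := by
    intro N
    induction N with
    | zero => exact ⟨[], rfl, by simp [C_nil]⟩
    | succ N ih =>
      obtain ⟨j, hj, hsub⟩ := ih
      have hx : S.Φ w S.x0 ∈ S.C w := ⟨_, rfl⟩
      obtain ⟨k, hk⟩ := S'.C_cover (hsub ⟨_, hx, rfl⟩)
      refine ⟨k :: j, by simp [hj], ?_⟩
      rintro _ ⟨y, hy, rfl⟩
      by_contra hy'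
      have h1 := S'.C_sep hk hy'
      have h2 := hf2 (S.Φ w S.x0) y
      have h3 := S.C_diam hx hy
      have h4 := hcon j hsub
      rw [div_mul_eq_mul_div, div_lt_iff₀ (by positivity)] at h4
      rw [R_cons] at h1
      have h5 : S'.β * R τ j ≤ τ k * R τ j :=
        mul_le_mul_of_nonneg_right (S'.hβρ k) (S'.Rpos j).le
      have h6 := mul_le_mul_of_nonneg_left h5 hc'.le
      have h7 := mul_le_mul_of_nonneg_left h3 hL.le
      nlinarith
  have hlim := (tendsto_pow_atTop_nhds_zero_of_lt_one S'.hθ0.le S'.hθ1).mul_const (L * S'.D)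
  rw [zero_mul] at hlim
  obtain ⟨N, hN⟩ := (hlim.eventually (gt_mem_nhds (show 0 < S.c * R ρ w by positivity))).exists
  obtain ⟨j, hj, hsub⟩ := step N
  let a := S.Φ w (S.φ ⟨0, by omega⟩ S.x0)
  let b := S.Φ w (S.φ ⟨1, by omega⟩ S.x0)
  have hab : S.c * R ρ w ≤ dist a b := by
    simp only [a, b, S.Φ_dist]
    have := S.sep ⟨0, by omega⟩ ⟨1, by omega⟩ S.x0 S.x0 (by simp)
    nlinarith
  have h1 := hf1 a b
  have h2 := S'.C_diam (hsub ⟨a, ⟨_, rfl⟩, rfl⟩) (hsub ⟨b, ⟨_, rfl⟩, rfl⟩)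
  have h3 := S'.R_le j
  rw [hj] at h3
  have h4 := mul_le_mul_of_nonneg_right h3 (show 0 ≤ L * S'.D by positivity)
  have h5 := mul_le_mul_of_nonneg_left h2 hL.le
  nlinarith

include hL hf1 in
lemma lemB (K : ℝ) (hK : 0 < K) : ∃ N : ℕ, ∀ w v j, R τ j ≤ K * R ρ w → S.β * R ρ w ≤ R ρ v →
    ∀ u : List (Fin n), u.length = N →
      S'.C (u ++ j) ⊆ f '' S.C v ∨ Disjoint (S'.C (u ++ j)) (f '' S.C v) := by
  have hD' := S'.hD
  have hc := S.hc
  have hβ := S.hβ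
  have hlim := (tendsto_pow_atTop_nhds_zero_of_lt_one S'.hθ0.le S'.hθ1).mul_const (L * S'.D * K)
  rw [zero_mul] at hlim
  obtain ⟨N, hN⟩ := (hlim.eventually (gt_mem_nhds (show 0 < S.c * S.β by positivity))).exists
  refine ⟨N, fun w v j hj hv u hu => ?_⟩
  by_contra hcon
  push Not at hcon
  obtain ⟨h1, h2⟩ := hcon
  obtain ⟨y', hy', hy'n⟩ := Set.not_subset.1 h1
  obtain ⟨y, hy, x, hx, rfl⟩ := Set.not_disjoint_iff.1 h2
  obtain ⟨x', rfl⟩ := f.surjective y'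
  have hx' : x' ∉ S.C v := fun h => hy'n ⟨x', h, rfl⟩
  have a1 := S.C_sep hx hx'
  have a2 := hf1 x x'
  have a3 := S'.C_diam hy hy'
  have a4 := S'.R_le u
  rw [hu] at a4
  rw [R_append] at a3
  have hRw := S.Rpos w
  have a5 : R τ u * R τ j ≤ S'.θ ^ N * (K * R ρ w) :=
    mul_le_mul a4 hj (S'.Rpos j).le (pow_nonneg S'.hθ0.le _)
  have a6 := mul_le_mul_of_nonneg_right a5 hD'.le
  have a7 := mul_le_mul_of_nonneg_left (a3.trans a6) hL.le
  have a8 := mul_le_mul_of_nonneg_left hv hc.le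
  have a9 := mul_lt_mul_of_pos_right hN hRw
  nlinarith

include hL hf1 hf2 S S' in
lemma main_h (hm : 2 ≤ m) (s : ℝ) (hs : 0 < s) (hτ : ∑ k, τ k ^ s = 1) :
    ∃ (h : List (Fin m) → ℝ) (M : ℝ) (N : ℕ), 0 < M ∧ h [] = 1 ∧ (∀ w, h w = ∑ k, h (k :: w)) ∧
      (∀ w, h w ≤ M * R (fun k => ρ k ^ s) w) ∧
      (∀ w, ∃ j, ∃ t ∈ T (fun k => τ k ^ s) N, h w = R (fun k => τ k ^ s) j * t ∧
        ∀ k, ∃ t' ∈ T (fun k => τ k ^ s) N, h (k :: w) = R (fun k => τ k ^ s) j * t') := by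
  obtain ⟨ν, hν0, hadd, hC⟩ := exists_nu S' (q := fun k => τ k ^ s)
    (fun k => Real.rpow_pos_of_pos (S'.pos k) s) hτ
  obtain ⟨K, hK, hA⟩ := lemA S S' f L hL hf1 hf2 hm
  obtain ⟨N, hN⟩ := lemB S S' f L hL hf1 K hK
  refine ⟨fun w => ν (f '' S.C w), K ^ s, N, Real.rpow_pos_of_pos hK s, ?_, ?_, ?_, ?_⟩
  · have := hC []
    rw [C_nil, R_nil] at this
    simp [C_nil, this]
  · intro w
    simp only
    rw [S.C_eq w, Set.image_iUnion, nu_iUnion hadd]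
    intro a b hab
    exact Set.disjoint_image_of_injective f.injective (S.C_disj w hab)
  · intro w
    obtain ⟨j, hj, hjR⟩ := hA w
    have h1 : ν (f '' S.C w) ≤ ν (S'.C j) := by
      rw [← Set.union_diff_cancel hj, hadd _ _ Set.disjoint_sdiff_right]
      linarith [hν0 (S'.C j \ f '' S.C w)]
    refine h1.trans ?_
    rw [hC, ← R_rpow S'.pos, ← R_rpow S.pos, ← Real.mul_rpow hK.le (S.Rpos w).le]
    exact Real.rpow_le_rpow (S'.Rpos j).le hjR hs.le
  · intro w
    obtain ⟨j, hj, hjR⟩ := hA w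
    refine ⟨j, ?_⟩
    have gen : ∀ v, f '' S.C v ⊆ S'.C j → S.β * R ρ w ≤ R ρ v →
        ∃ t ∈ T (fun k => τ k ^ s) N, ν (f '' S.C v) = R (fun k => τ k ^ s) j * t := by
      intro v hv hv2
      have := S'.nu_T hadd hC (f '' S.C v) N j (hN w v j hjR hv2)
      rwa [Set.inter_eq_left.2 hv] at this
    have hRw := S.Rpos w
    have hβ1 : ∀ k, S.β * R ρ w ≤ R ρ (k :: w) := fun k => by
      rw [R_cons]; exact mul_le_mul_of_nonneg_right (S.hβρ k) hRw.le
    have hβ0 : S.β * R ρ w ≤ R ρ w := by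
      have h1 := S.hβρ ⟨0, by omega⟩
      have h2 := S.hθ ⟨0, by omega⟩
      have h3 := S.hθ1
      nlinarith
    obtain ⟨t, ht, e⟩ := gen w hj hβ0
    exact ⟨t, ht, e, fun k => gen (k :: w)
      ((Set.image_mono (S.C_cons_sub k w)).trans hj) (hβ1 k)⟩

include hL hf1 hf2 S S' in
lemma dim_le (hm : 2 ≤ m) (s : ℝ) (hs : 0 < s) (hτ : ∑ k, τ k ^ s = 1) :
    1 ≤ ∑ k, ρ k ^ s := by
  obtain ⟨h, M, N, hM0, h0, hsum, hM, -⟩ := main_h S S' f L hL hf1 hf2 hm s hs hτ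
  by_contra hcon
  push Not at hcon
  set Θ := ∑ k, ρ k ^ s with hΘ
  have hΘ0 : 0 ≤ Θ := Finset.sum_nonneg fun k _ => (Real.rpow_pos_of_pos (S.pos k) s).le
  have key : ∀ (N : ℕ) w, h w ≤ M * R (fun k => ρ k ^ s) w * Θ ^ N := by
    intro N
    induction N with
    | zero => simpa using hM
    | succ N ih =>
      intro w
      rw [hsum]
      refine (Finset.sum_le_sum fun k _ => ih (k :: w)).trans (le_of_eq ?_)
      simp only [R_cons]
      rw [pow_succ, hΘ, Finset.mul_sum, Finset.mul_sum]
      refine Finset.sum_congr rfl fun k _ => ?_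
      ring
  have hlim := (tendsto_pow_atTop_nhds_zero_of_lt_one hΘ0 hcon).const_mul M
  rw [mul_zero] at hlim
  obtain ⟨N, hN⟩ := (hlim.eventually (gt_mem_nhds one_pos)).exists
  have := key N []
  rw [h0, R_nil, mul_one] at this
  linarith

include hL hf1 hf2 S S' in
lemma field_le (hm : 2 ≤ m) (s : ℝ) (hs : 0 < s) (hτ : ∑ k, τ k ^ s = 1)
    (hρ : ∑ k, ρ k ^ s = 1) :
    IntermediateField.adjoin ℚ (Set.range fun i => ρ i ^ s) ≤
        IntermediateField.adjoin ℚ (Set.range fun k => τ k ^ s) := by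
  obtain ⟨h, M, N, hM0, h0, hsum, hM, hr⟩ := main_h S S' f L hL hf1 hf2 hm s hs hτ
  obtain ⟨w, hw, hk⟩ := abstract_max (p := fun k => ρ k ^ s)
    (fun k => Real.rpow_pos_of_pos (S.pos k) s) hρ h h0 hsum M hM _ (T_fin _ N)
    (fun w => by
      obtain ⟨j, H⟩ := hr w
      exact ⟨_, H⟩)
  set Kf := IntermediateField.adjoin ℚ (Set.range fun k => τ k ^ s) with hKf
  have hq : ∀ k, τ k ^ s ∈ Kf := fun k => IntermediateField.subset_adjoin _ _ ⟨k, rfl⟩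
  rw [IntermediateField.adjoin_le_iff]
  rintro _ ⟨k, rfl⟩
  obtain ⟨j, t, ht, e, H⟩ := hr w
  obtain ⟨t', ht', e'⟩ := H k
  have m1 : h w ∈ Kf := by
    rw [e]; exact Kf.mul_mem (R_field _ Kf hq j) (T_field _ Kf hq N t ht)
  have m2 : h (k :: w) ∈ Kf := by
    rw [e']; exact Kf.mul_mem (R_field _ Kf hq j) (T_field _ Kf hq N t' ht')
  have : ρ k ^ s = h (k :: w) / h w := by rw [hk k]; field_simp
  simp only [SetLike.mem_coe]
  rw [this]
  exact Kf.div_mem m2 m1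

end geom

end DS

lemma exists_dim {m : ℕ} (hm : 2 ≤ m) (ρ : Fin m → ℝ) (h : ∀ j, ρ j ∈ Set.Ioo (0:ℝ) 1) :
    ∃ s : ℝ, 0 < s ∧ ∑ k, ρ k ^ s = 1 := by
  have hcont : Continuous fun s : ℝ => ∑ k, ρ k ^ s :=
    continuous_finsetSum _ fun k _ => Real.continuous_const_rpow (h k).1.ne'
  have hlim : Filter.Tendsto (fun s : ℝ => ∑ k, ρ k ^ s) Filter.atTop (nhds 0) := by
    have := tendsto_finsetSum (Finset.univ : Finset (Fin m)) (fun k _ =>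
      tendsto_rpow_atTop_of_base_lt_one (ρ k) (by linarith [(h k).1]) (h k).2)
    simpa using this
  obtain ⟨b, hb, hb0⟩ := ((hlim.eventually (gt_mem_nhds one_pos)).and
    (Filter.eventually_gt_atTop 0)).exists
  have h0 : (1:ℝ) < ∑ k, ρ k ^ (0:ℝ) := by
    simp only [Real.rpow_zero, Finset.sum_const, Finset.card_univ, Fintype.card_fin, nsmul_eq_mul,
      mul_one]
    exact_mod_cast hm
  obtain ⟨s, hs, hs1⟩ := intermediate_value_Icc' hb0.le hcont.continuousOn ⟨hb.le, h0.le⟩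
  refine ⟨s, lt_of_le_of_ne hs.1 ?_, hs1⟩
  rintro rfl
  simp only at hs1
  linarith

lemma dim_anti {m : ℕ} (hm : 2 ≤ m) (ρ : Fin m → ℝ) (h : ∀ j, ρ j ∈ Set.Ioo (0:ℝ) 1)
    {s t : ℝ} (hs : ∑ k, ρ k ^ s = 1) (ht : 1 ≤ ∑ k, ρ k ^ t) : t ≤ s := by
  by_contra hcon
  push Not at hcon
  have : ∑ k, ρ k ^ t < ∑ k, ρ k ^ s :=
    Finset.sum_lt_sum_of_nonempty ⟨⟨0, by omega⟩, Finset.mem_univ _⟩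
      fun k _ => Real.rpow_lt_rpow_of_exponent_gt (h k).1 (h k).2 hcon
  linarith

lemma exists_DS {d m : ℕ} (hm : 2 ≤ m) (ρ : Fin m → ℝ) (E : Set (EuclideanSpace ℝ (Fin d)))
    (hE : IsDustLike E ρ) : Nonempty (DS E m ρ) := by
  obtain ⟨hcomp, ⟨x0, hx0⟩, hρ, φ, hsim, hcov, hdis⟩ := hE
  have hmap : ∀ j, ∀ x ∈ E, φ j x ∈ E := fun j x hx => by
    rw [hcov]; exact Set.mem_iUnion.2 ⟨j, x, hx, rfl⟩
  have hne : Nonempty (Fin m) := ⟨⟨0, by omega⟩⟩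
  obtain ⟨jM, hjM⟩ := Finite.exists_max ρ
  obtain ⟨jm, hjm⟩ := Finite.exists_min ρ
  have hcφ : ∀ j, Continuous (φ j) := fun j =>
    (LipschitzWith.of_dist_le_mul (K := ⟨ρ j, (hρ j).1.le⟩) fun x y => (hsim j x y).le).continuous
  have hsep : ∀ p : Fin m × Fin m, ∃ c : ℝ, 0 < c ∧ (p.1 ≠ p.2 → ∀ x ∈ E, ∀ y ∈ E,
      c ≤ dist (φ p.1 x) (φ p.2 y)) := by
    rintro ⟨j, k⟩
    by_cases hjk : j = k
    · exact ⟨1, one_pos, fun h => absurd hjk h⟩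
    obtain ⟨⟨a, b⟩, ⟨ha, hb⟩, hab⟩ := (hcomp.prod hcomp).exists_isMinOn ⟨(x0, x0), hx0, hx0⟩
      (f := fun p => dist (φ j p.1) (φ k p.2))
      (((hcφ j).comp continuous_fst).dist ((hcφ k).comp continuous_snd)).continuousOn
    refine ⟨dist (φ j a) (φ k b), dist_pos.2 ?_, fun _ x hx y hy => hab (a := (x, y)) ⟨hx, hy⟩⟩
    intro e
    exact Set.disjoint_left.1 (hdis hjk) ⟨a, ha, rfl⟩ ⟨b, hb, e.symm⟩
  choose c hc0 hc using hsep
  obtain ⟨pm, hpm⟩ := Finite.exists_min c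
  exact ⟨{
    φ := fun j x => ⟨φ j x, hmap j x x.2⟩
    sim := fun j x y => hsim j x y
    cover := fun x => by
      obtain ⟨j, y, hy, e⟩ := Set.mem_iUnion.1 (hcov.subset x.2)
      exact ⟨j, ⟨y, hy⟩, Subtype.ext e⟩
    D := Metric.diam E + 1
    hD := by linarith [Metric.diam_nonneg (s := E)]
    bdd := fun x y => by
      have := Metric.dist_le_diam_of_mem hcomp.isBounded x.2 y.2
      rw [Subtype.dist_eq]
      linarith
    c := c pm
    hc := hc0 pm
    sep := fun j k x y hjk => (hpm (j, k)).trans (hc (j, k) hjk x x.2 y y.2)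
    θ := ρ jM
    hθ1 := (hρ jM).2
    hθ := hjM
    hθ0 := (hρ jM).1
    β := ρ jm
    hβ := (hρ jm).1
    hβρ := hjm
    x0 := ⟨x0, hx0⟩ }⟩

theorem stmt1 {d d' m n : ℕ} (hm : 2 ≤ m) (hn : 2 ≤ n)
    (ρ : Fin m → ℝ) (τ : Fin n → ℝ)
    (E : Set (EuclideanSpace ℝ (Fin d))) (F : Set (EuclideanSpace ℝ (Fin d')))
    (hE : IsDustLike E ρ) (hF : IsDustLike F τ) (h : LipEquiv E F) :
    ∃ δ : ℝ, 0 < δ ∧ (∑ i, ρ i ^ δ) = 1 ∧ (∑ k, τ k ^ δ) = 1 ∧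
      IntermediateField.adjoin ℚ (Set.range fun i => ρ i ^ δ) =
        IntermediateField.adjoin ℚ (Set.range fun k => τ k ^ δ) := by
  obtain ⟨S⟩ := exists_DS hm ρ E hE
  obtain ⟨S'⟩ := exists_DS hn τ F hF
  obtain ⟨f, hbij, L, hL, hf⟩ := h
  have hρ := hE.2.2.1
  have hτ := hF.2.2.1
  let e : E ≃ F := Equiv.ofBijective f hbij
  have e1 : ∀ x y : E, dist x y ≤ L * dist (e x) (e y) := fun x y => by
    have := (hf x y).1
    rwa [inv_mul_le_iff₀ hL] at this
  have e2 : ∀ x y : E, dist (e x) (e y) ≤ L * dist x y := fun x y => (hf x y).2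
  have e3 : ∀ x y : F, dist x y ≤ L * dist (e.symm x) (e.symm y) := fun x y => by
    simpa using e2 (e.symm x) (e.symm y)
  have e4 : ∀ x y : F, dist (e.symm x) (e.symm y) ≤ L * dist x y := fun x y => by
    simpa using e1 (e.symm x) (e.symm y)
  obtain ⟨s, hs, hs1⟩ := exists_dim hm ρ hρ
  obtain ⟨t, ht, ht1⟩ := exists_dim hn τ hτ
  have h1 : t ≤ s := dim_anti hm ρ hρ hs1 (DS.dim_le S S' e L hL e1 e2 hm t ht ht1)
  have h2 : s ≤ t := dim_anti hn τ hτ ht1 (DS.dim_le S' S e.symm L hL e3 e4 hn s hs hs1)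
  obtain rfl : s = t := le_antisymm h2 h1
  exact ⟨s, hs, hs1, ht1, le_antisymm (DS.field_le S S' e L hL e1 e2 hm s hs ht1 hs1)
    (DS.field_le S' S e.symm L hL e3 e4 hn s hs hs1 ht1)⟩
end
end

section
/- Let ρ = (ρ_1,…,ρ_m) and τ = (τ_1,…,τ_n) have all entries in (0,1), with m, n ≥ 2, and suppose log ρ_1,…,log ρ_m are linearly independent over ℚ and log τ_1,…,log τ_n are linearly independent over ℚ (i.e. both vectors have full rank). Let E ⊆ ℝ^d and F ⊆ ℝ^{d'} be dust-like self-similar sets with contraction vectors ρ and τ respectively. Then E and F are Lipschitz equivalent if and only if n = m and τ is a permutation of ρ (i.e. ρ and τ coincide as multisets). -/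
open scoped BigOperators

noncomputable section

set_option linter.unusedSectionVars false
set_option linter.unusedVariables false

section Basics

variable {α : Type} [Fintype α]

/-- weight of a prefix -/
def SymW (p : α → ℝ) (x : ℕ → α) (k : ℕ) : ℝ := ∏ i ∈ Finset.range k, p (x i)

lemma symW_zero (p : α → ℝ) (x : ℕ → α) : SymW p x 0 = 1 := by simp [SymW]

lemma symW_succ (p : α → ℝ) (x : ℕ → α) (k : ℕ) :
    SymW p x (k+1) = SymW p x k * p (x k) := by simp [SymW, Finset.prod_range_succ]

lemma symW_pos {p : α → ℝ} (hp : ∀ i, p i ∈ Set.Ioo (0:ℝ) 1) (x : ℕ → α) (k : ℕ) :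
    0 < SymW p x k := Finset.prod_pos fun i _ => (hp _).1

lemma symW_anti {p : α → ℝ} (hp : ∀ i, p i ∈ Set.Ioo (0:ℝ) 1) (x : ℕ → α) :
    Antitone (SymW p x) := by
  apply antitone_nat_of_succ_le
  intro k
  rw [symW_succ]
  exact mul_le_of_le_one_right (symW_pos hp x k).le (hp _).2.le

lemma symW_congr (p : α → ℝ) {x y : ℕ → α} {k : ℕ} (h : ∀ i < k, x i = y i) :
    SymW p x k = SymW p y k := by
  unfold SymW
  exact Finset.prod_congr rfl fun i hi => by rw [h i (Finset.mem_range.1 hi)]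

lemma symW_add_le {p : α → ℝ} (hp : ∀ i, p i ∈ Set.Ioo (0:ℝ) 1) {b : ℝ} (hb : ∀ i, p i ≤ b)
    (x : ℕ → α) (k l : ℕ) : SymW p x (k + l) ≤ SymW p x k * b ^ l := by
  induction l with
  | zero => simp
  | succ l ih =>
    rw [← add_assoc, symW_succ, pow_succ, ← mul_assoc]
    have := symW_pos hp x (k+l)
    have h0 := (hp (x (k+l))).1
    exact mul_le_mul ih (hb _) h0.le (this.le.trans ih)

lemma exists_max_lt {p : α → ℝ} (hp : ∀ i, p i ∈ Set.Ioo (0:ℝ) 1) :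
    ∃ b : ℝ, 0 < b ∧ b < 1 ∧ ∀ i, p i ≤ b := by
  have h : ∀ᶠ b in nhdsWithin (1:ℝ) (Set.Iio 1), ∀ i, p i ≤ b := by
    rw [Filter.eventually_all]
    intro i
    filter_upwards [Ioo_mem_nhdsLT (hp i).2] with b hb using hb.1.le
  obtain ⟨b, h1, h2⟩ := (h.and (Ioo_mem_nhdsLT (zero_lt_one))).exists
  exact ⟨b, h2.1, h2.2, h1⟩

lemma exists_min_pos {ι : Type*} [Finite ι] {p : ι → ℝ} (hp : ∀ i, 0 < p i) :
    ∃ b : ℝ, 0 < b ∧ ∀ i, b ≤ p i := by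
  have h : ∀ᶠ b in nhdsWithin (0:ℝ) (Set.Ioi 0), ∀ i, b ≤ p i := by
    rw [Filter.eventually_all]
    intro i
    filter_upwards [Ioo_mem_nhdsGT (hp i)] with b hb using hb.2.le
  obtain ⟨b, h1, h2⟩ := (h.and self_mem_nhdsWithin).exists
  exact ⟨b, h2, h1⟩

end Basics

section Coding
open PiNat

lemma coding {d : ℕ} {α : Type} [Fintype α]
    (E : Set (EuclideanSpace ℝ (Fin d))) (ρ : α → ℝ) (hE : IsDustLike E ρ) :
    ∃ a : E ≃ (ℕ → α), ∃ D : ℝ, 0 < D ∧ ∀ x y : E, x ≠ y →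
      dist x y ≤ D * SymW ρ (a x) (firstDiff (a x) (a y)) ∧
      SymW ρ (a x) (firstDiff (a x) (a y)) ≤ D * dist x y := by
  obtain ⟨hc, hne, hρ, φ, hφ, hEq, hdisj⟩ := hE
  have hinj : ∀ j, Function.Injective (φ j) := by
    intro j x y hxy
    have := hφ j x y
    rw [hxy, dist_self] at this
    have h2 := (hρ j).1
    exact dist_eq_zero.1 (by nlinarith [dist_nonneg (x := x) (y := y)])
  have hcont : ∀ j, Continuous (φ j) := by
    intro j
    have : LipschitzWith (Real.toNNReal (ρ j)) (φ j) := by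
      apply LipschitzWith.of_dist_le_mul
      intro x y
      rw [hφ, Real.coe_toNNReal _ (hρ j).1.le]
    exact this.continuous
  have hmem : ∀ e : E, ∃ j, ∃ e' : E, φ j e' = e := by
    intro e
    have h := hEq.subset e.2
    obtain ⟨j, e', he', h⟩ := Set.mem_iUnion.1 h
    exact ⟨j, ⟨e', he'⟩, h⟩
  choose J S hS using hmem
  have hφE : ∀ j (e : E), φ j e ∈ E := by
    intro j e
    exact hEq.symm.subset (Set.mem_iUnion.2 ⟨j, e, e.2, rfl⟩)
  have hJ : ∀ j (e : E), J ⟨φ j e, hφE j e⟩ = j := by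
    intro j e
    by_contra hne
    have := hdisj hne
    exact Set.disjoint_left.1 this ⟨_, (S ⟨φ j e, hφE j e⟩).2, hS _⟩ ⟨e, e.2, rfl⟩
  have hSS : ∀ j (e : E), S ⟨φ j e, hφE j e⟩ = e := by
    intro j e
    have h1 := hS ⟨φ j e, hφE j e⟩
    rw [hJ] at h1
    exact Subtype.ext (hinj j h1)
  let a : E → ℕ → α := fun e k => J (S^[k] e)
  have hdist : ∀ (e e' : E) k, (∀ i < k, a e i = a e' i) →
      dist e e' = SymW ρ (a e) k * dist (S^[k] e) (S^[k] e') := by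
    intro e e' k
    induction k with
    | zero => simp [symW_zero]
    | succ k ih =>
      intro h
      rw [ih (fun i hi => h i (by omega)), symW_succ, mul_assoc]
      congr 1
      rw [Function.iterate_succ_apply', Function.iterate_succ_apply']
      have h1 := hφ (J (S^[k] e)) (S (S^[k] e)) (S (S^[k] e'))
      rw [hS] at h1
      have h2 : J (S^[k] e) = J (S^[k] e') := h k (by omega)
      nth_rw 1 [h2] at h1
      rw [hS] at h1
      exact h1
  obtain ⟨δ, hδ, hδd⟩ : ∃ δ : ℝ, 0 < δ ∧ ∀ e e' : E, J e ≠ J e' → δ ≤ dist e e' := by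
    have : ∀ q : α × α, ∃ r : ℝ, 0 < r ∧ (q.1 ≠ q.2 → ∀ x ∈ φ q.1 '' E, ∀ y ∈ φ q.2 '' E, r ≤ dist x y) := by
      intro q
      by_cases hq : q.1 = q.2
      · exact ⟨1, one_pos, fun h => absurd hq h⟩
      · obtain ⟨r, hr, h⟩ := Metric.exists_pos_forall_lt_edist (hc.image (hcont q.1))
          (hc.image (hcont q.2)).isClosed (hdisj hq)
        refine ⟨r, hr, fun _ x hx y hy => ?_⟩
        have := h x hx y hy
        rw [edist_nndist] at this
        have h2 : r < nndist x y := by exact_mod_cast this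
        rw [dist_nndist]
        exact_mod_cast h2.le
    choose r hr h using this
    obtain ⟨δ, hδ, hle⟩ := exists_min_pos hr
    refine ⟨δ, hδ, fun e e' hJJ => (hle (J e, J e')).trans ?_⟩
    exact h (J e, J e') hJJ e ⟨_, (S e).2, hS e⟩ e' ⟨_, (S e').2, hS e'⟩
  have hlow : ∀ e e' : E, a e ≠ a e' → SymW ρ (a e) (firstDiff (a e) (a e')) * δ ≤ dist e e' := by
    intro e e' h
    rw [hdist e e' (firstDiff (a e) (a e')) (fun i hi => apply_eq_of_lt_firstDiff hi)]
    exact mul_le_mul_of_nonneg_left (hδd _ _ (apply_firstDiff_ne h)) (symW_pos hρ _ _).le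
  obtain ⟨M, hM⟩ := Metric.isBounded_iff.1 hc.isBounded
  have hM' : ∀ e e' : E, dist e e' ≤ M := fun e e' => hM e.2 e'.2
  have hM0 : 0 ≤ M := by
    obtain ⟨z, hz⟩ := hne
    simpa using hM hz hz
  have hup : ∀ (e e' : E) k, (∀ i < k, a e i = a e' i) → dist e e' ≤ SymW ρ (a e) k * M := by
    intro e e' k h
    rw [hdist e e' k h]
    exact mul_le_mul_of_nonneg_left (hM' _ _) (symW_pos hρ _ _).le
  have hainj : Function.Injective a := by
    intro e e' h
    obtain ⟨b, hb0, hb1, hb⟩ := exists_max_lt hρ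
    have h1 : ∀ k, dist e e' ≤ b ^ k * M := by
      intro k
      refine (hup e e' k (fun i _ => by rw [h])).trans ?_
      have := symW_add_le hρ hb (a e) 0 k
      rw [symW_zero, zero_add, one_mul] at this
      exact mul_le_mul_of_nonneg_right this hM0
    have h2 : Filter.Tendsto (fun k : ℕ => b ^ k * M) Filter.atTop (nhds (0 * M)) :=
      (tendsto_pow_atTop_nhds_zero_of_lt_one hb0.le hb1).mul_const M
    have h3 := ge_of_tendsto' h2 h1
    rw [zero_mul] at h3
    exact dist_le_zero.1 h3
  have hasurj : Function.Surjective a := by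
    intro x
    have happ : ∀ k, ∀ x : ℕ → α, ∃ e : E, ∀ i < k, a e i = x i := by
      intro k
      induction k with
      | zero => intro x; obtain ⟨z, hz⟩ := hne; exact ⟨⟨z, hz⟩, by simp⟩
      | succ k ih =>
        intro x
        obtain ⟨e, he⟩ := ih (fun i => x (i+1))
        refine ⟨⟨φ (x 0) e, hφE _ _⟩, ?_⟩
        intro i hi
        cases i with
        | zero => exact hJ _ _
        | succ i =>
          change J (S^[i+1] _) = _
          rw [Function.iterate_succ_apply, hSS]
          exact he i (by omega)
    choose e he using fun k => happ k x
    obtain ⟨z, hz, θ, hθ, hlim⟩ := hc.tendsto_subseq (x := fun k => (e k : EuclideanSpace ℝ (Fin d)))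
      (fun k => (e k).2)
    refine ⟨⟨z, hz⟩, ?_⟩
    by_contra hcon
    set w : E := ⟨z, hz⟩
    set k := firstDiff (a w) x with hk
    have hpos : 0 < SymW ρ (a w) k * δ := mul_pos (symW_pos hρ _ _) hδ
    obtain ⟨N, hN⟩ := Metric.tendsto_atTop.1 hlim _ hpos
    have h1 := hN (max N (k+1)) (le_max_left _ _)
    have h2 : k < θ (max N (k+1)) := lt_of_lt_of_le (by omega) ((le_max_right N (k+1)).trans (hθ.le_apply))
    set e' := e (θ (max N (k+1)))
    have h3 : a w k ≠ a e' k := by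
      rw [he _ _ h2]
      exact apply_firstDiff_ne hcon
    have h4 : a w ≠ a e' := fun h => h3 (by rw [h])
    have h5 : firstDiff (a w) (a e') ≤ k := by
      by_contra hlt
      exact h3 (apply_eq_of_lt_firstDiff (not_le.1 hlt))
    have h6 := hlow w e' h4
    have h7 := symW_anti hρ (a w) h5
    have h8 : dist w e' < SymW ρ (a w) k * δ := by
      rw [dist_comm]; exact h1
    nlinarith
  have hbij : Function.Bijective a := ⟨hainj, hasurj⟩
  refine ⟨Equiv.ofBijective a hbij, M + δ⁻¹, by positivity, ?_⟩
  intro x y hxy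
  simp only [Equiv.ofBijective_apply]
  have hW := symW_pos hρ (a x) (firstDiff (a x) (a y))
  have hδi : 0 < δ⁻¹ := inv_pos.2 hδ
  constructor
  · have := hup x y (firstDiff (a x) (a y)) (fun i hi => apply_eq_of_lt_firstDiff hi)
    nlinarith
  · have h1 := hlow x y (fun h => hxy (hainj h))
    have h2 : SymW ρ (a x) (firstDiff (a x) (a y)) ≤ δ⁻¹ * dist x y := by
      rw [← div_eq_inv_mul, le_div_iff₀ hδ]; exact h1
    nlinarith [dist_nonneg (x := x) (y := y)]

/-- bilipschitz equivalence of symbolic spaces -/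
def SymBL {α β : Type} (ρ : α → ℝ) (τ : β → ℝ) (e : (ℕ → α) ≃ (ℕ → β)) (C : ℝ) : Prop :=
  ∀ x y, x ≠ y → SymW ρ x (firstDiff x y) ≤ C * SymW τ (e x) (firstDiff (e x) (e y)) ∧
    SymW τ (e x) (firstDiff (e x) (e y)) ≤ C * SymW ρ x (firstDiff x y)

lemma SymBL.symm {α β : Type} {ρ : α → ℝ} {τ : β → ℝ} {e : (ℕ → α) ≃ (ℕ → β)} {C : ℝ}
    (h : SymBL ρ τ e C) : SymBL τ ρ e.symm C := by
  intro x y hxy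
  have := h (e.symm x) (e.symm y) (fun hh => hxy (e.symm.injective hh))
  simp only [Equiv.apply_symm_apply] at this
  exact ⟨this.2, this.1⟩

lemma exists_symBL {d d' : ℕ} {α β : Type} [Fintype α] [Fintype β] {ρ : α → ℝ} {τ : β → ℝ}
    {E : Set (EuclideanSpace ℝ (Fin d))} {F : Set (EuclideanSpace ℝ (Fin d'))}
    (hE : IsDustLike E ρ) (hF : IsDustLike F τ) (h : LipEquiv E F) :
    ∃ (e : (ℕ → α) ≃ (ℕ → β)) (C : ℝ), 0 < C ∧ SymBL ρ τ e C := by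
  obtain ⟨f, hf, C, hC, hfC⟩ := h
  obtain ⟨a, D, hD, ha⟩ := coding E ρ hE
  obtain ⟨b, D', hD', hb⟩ := coding F τ hF
  refine ⟨a.symm.trans ((Equiv.ofBijective f hf).trans b), D * C * D', by positivity, ?_⟩
  intro x y hxy
  have hne : a.symm x ≠ a.symm y := fun hh => hxy (a.symm.injective hh)
  have h1 := ha (a.symm x) (a.symm y) hne
  have h2 := hb (f (a.symm x)) (f (a.symm y)) (fun hh => hne (hf.1 hh))
  have h3 := hfC (a.symm x) (a.symm y)
  simp only [Equiv.apply_symm_apply] at h1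
  simp only [Equiv.trans_apply, Equiv.ofBijective_apply]
  rw [← Subtype.dist_eq, ← Subtype.dist_eq] at h3
  set A := SymW ρ x (firstDiff x y)
  set B := SymW τ (b (f (a.symm x))) (firstDiff (b (f (a.symm x))) (b (f (a.symm y))))
  set u := dist (a.symm x) (a.symm y)
  set v := dist (f (a.symm x)) (f (a.symm y))
  have h4 : u ≤ C * v := by
    have := h3.1
    rwa [← div_eq_inv_mul, div_le_iff₀' hC] at this
  constructor
  · calc A ≤ D * u := h1.2
      _ ≤ D * (C * v) := by gcongr
      _ ≤ D * (C * (D' * B)) := by gcongr; exact h2.1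
      _ = _ := by ring
  · calc B ≤ D' * v := h2.2
      _ ≤ D' * (C * u) := by gcongr; exact h3.2
      _ ≤ D' * (C * (D * A)) := by gcongr; exact h1.1
      _ = _ := by ring

lemma lipEquiv_of_perm {d d' : ℕ} {α β : Type} [Fintype α] [Fintype β] {ρ : α → ℝ} {τ : β → ℝ}
    {E : Set (EuclideanSpace ℝ (Fin d))} {F : Set (EuclideanSpace ℝ (Fin d'))}
    (hE : IsDustLike E ρ) (hF : IsDustLike F τ) (σ : α ≃ β) (hσ : ∀ i, τ (σ i) = ρ i) :
    LipEquiv E F := by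
  obtain ⟨a, D, hD, ha⟩ := coding E ρ hE
  obtain ⟨b, D', hD', hb⟩ := coding F τ hF
  let s : (ℕ → α) ≃ (ℕ → β) := Equiv.arrowCongr (Equiv.refl ℕ) σ
  have hs : ∀ x i, s x i = σ (x i) := fun x i => rfl
  let f : E ≃ F := a.trans (s.trans b.symm)
  refine ⟨f, f.bijective, D * D', by positivity, ?_⟩
  intro x y
  rw [← Subtype.dist_eq, ← Subtype.dist_eq]
  by_cases hxy : x = y
  · subst hxy; simp
  have h1 := ha x y hxy
  have h2 := hb (f x) (f y) (fun h => hxy (f.injective h))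
  have hbf : ∀ x, b (f x) = s (a x) := by intro x; simp [f]
  rw [hbf, hbf] at h2
  have hfd : firstDiff (s (a x)) (s (a y)) = firstDiff (a x) (a y) := by
    have n1 : a x ≠ a y := fun h => hxy (a.injective h)
    have n2 : s (a x) ≠ s (a y) := fun h => n1 (s.injective h)
    apply le_antisymm
    · by_contra hlt
      have := apply_eq_of_lt_firstDiff (not_le.1 hlt)
      rw [hs, hs] at this
      exact apply_firstDiff_ne n1 (σ.injective this)
    · by_contra hlt
      have := apply_eq_of_lt_firstDiff (not_le.1 hlt)
      apply apply_firstDiff_ne n2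
      rw [hs, hs, this]
  have hW : SymW τ (s (a x)) (firstDiff (a x) (a y)) = SymW ρ (a x) (firstDiff (a x) (a y)) := by
    unfold SymW
    exact Finset.prod_congr rfl fun i _ => by rw [hs, hσ]
  rw [hfd, hW] at h2
  set A := SymW ρ (a x) (firstDiff (a x) (a y))
  constructor
  · rw [← div_eq_inv_mul, div_le_iff₀' (by positivity)]
    calc dist x y ≤ D * A := h1.1
      _ ≤ D * (D' * dist (f x) (f y)) := by gcongr; exact h2.2
      _ = _ := by ring
  · calc dist (f x) (f y) ≤ D' * A := h2.1
      _ ≤ D' * (D * dist x y) := by gcongr; exact h1.2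
      _ = _ := by ring

end Coding

section Dim

variable {α : Type} [Fintype α]

lemma symW_rpow {p : α → ℝ} (hp : ∀ i, p i ∈ Set.Ioo (0:ℝ) 1) (s : ℝ) (x : ℕ → α) (k : ℕ) :
    SymW (fun i => p i ^ s) x k = SymW p x k ^ s := by
  unfold SymW
  rw [Real.finsetProd_rpow _ _ (fun i _ => (hp _).1.le)]

lemma rpow_mem_Ioo {p : α → ℝ} (hp : ∀ i, p i ∈ Set.Ioo (0:ℝ) 1) {s : ℝ} (hs : 0 < s) (i : α) :
    p i ^ s ∈ Set.Ioo (0:ℝ) 1 :=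
  ⟨Real.rpow_pos_of_pos (hp i).1 s, Real.rpow_lt_one (hp i).1.le (hp i).2 hs⟩


lemma exists_dim_s2 {α : Type} [Fintype α] [Nontrivial α] {ρ : α → ℝ}
    (hρ : ∀ i, ρ i ∈ Set.Ioo (0:ℝ) 1) : ∃ s : ℝ, 0 < s ∧ ∑ i, ρ i ^ s = 1 := by
  have hcont : Continuous fun s : ℝ => ∑ i, ρ i ^ s := by
    refine continuous_finsetSum _ fun i _ => ?_
    exact Real.continuous_const_rpow (hρ i).1.ne'
  have hcard : (1:ℝ) < Fintype.card α := by exact_mod_cast Fintype.one_lt_card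
  have h0 : ∃ s : ℝ, 1 ≤ ∑ i, ρ i ^ s := ⟨0, by simpa using hcard.le⟩
  have hlim : Filter.Tendsto (fun s : ℝ => ∑ i, ρ i ^ s) Filter.atTop (nhds (∑ i : α, (0:ℝ))) := by
    refine tendsto_finsetSum _ fun i _ => ?_
    exact tendsto_rpow_atTop_of_base_lt_one _ (by linarith [(hρ i).1]) (hρ i).2
  have h1 : ∃ s : ℝ, ∑ i, ρ i ^ s ≤ 1 := by
    simp only [Finset.sum_const_zero] at hlim
    obtain ⟨s, hs⟩ := (hlim.eventually (gt_mem_nhds (zero_lt_one))).exists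
    exact ⟨s, hs.le⟩
  obtain ⟨s, hs⟩ := mem_range_of_exists_le_of_exists_ge hcont h1 h0
  refine ⟨s, ?_, hs⟩
  by_contra hle
  have h2 : ∑ i : α, (1:ℝ) ≤ ∑ i, ρ i ^ s :=
    Finset.sum_le_sum fun i _ => Real.one_le_rpow_of_pos_of_le_one_of_nonpos (hρ i).1 (hρ i).2.le (not_lt.1 hle)
  simp at h2
  simp only at hs
  linarith

end Dim

section Meas
open PiNat
open MeasureTheory hiding cylinder

variable {β : Type} [Fintype β] [MeasurableSpace β] [MeasurableSingletonClass β]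

lemma measurableSet_cyl (z : ℕ → β) (l : ℕ) : MeasurableSet (cylinder z l) := by
  rw [cylinder_eq_pi]
  exact MeasurableSet.pi (Set.to_countable _) fun i _ => measurableSet_singleton _

lemma exists_measure {q : β → ℝ} (hq : ∀ i, q i ∈ Set.Ioo (0:ℝ) 1) (hsum : ∑ i, q i = 1) :
    ∃ ν : Measure (ℕ → β), IsProbabilityMeasure ν ∧ ∀ z l, ν.real (cylinder z l) = SymW q z l := by
  let μ0 : Measure β := ∑ j, ENNReal.ofReal (q j) • Measure.dirac j
  have h1 : ∀ j, μ0 {j} = ENNReal.ofReal (q j) := by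
    intro j
    classical
    simp only [μ0, Measure.coe_finsetSum, Finset.sum_apply, Measure.smul_apply,
      Measure.dirac_apply' _ (measurableSet_singleton j), smul_eq_mul, Set.indicator_apply,
      Set.mem_singleton_iff, Pi.one_apply, mul_ite, mul_one, mul_zero]
    simp
  have hp : IsProbabilityMeasure μ0 := by
    constructor
    simp only [μ0, Measure.coe_finsetSum, Finset.sum_apply, Measure.smul_apply, smul_eq_mul,
      measure_univ, mul_one]
    rw [← ENNReal.ofReal_sum_of_nonneg (fun i _ => (hq i).1.le), hsum, ENNReal.ofReal_one]
  refine ⟨Measure.infinitePi fun _ : ℕ => μ0, inferInstance, ?_⟩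
  intro z l
  have h2 : cylinder z l = Set.pi (Finset.range l : Set ℕ) fun i => {z i} := by
    rw [cylinder_eq_pi]
  rw [h2, measureReal_def, Measure.infinitePi_pi (fun _ => μ0) (fun i _ => measurableSet_singleton _),
    ENNReal.toReal_prod]
  unfold SymW
  refine Finset.prod_congr rfl fun i _ => ?_
  rw [h1, ENNReal.toReal_ofReal (hq _).1.le]

/-- finitely determined subsets of a cylinder -/
def SymShape (z : ℕ → β) (l L : ℕ) (pat : Finset (Fin L → β)) : Set (ℕ → β) :=
  {w | (∀ i < l, w i = z i) ∧ (fun i : Fin L => w (l + i)) ∈ pat}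

/-- gluing a word after a prefix -/
def symGlue (z : ℕ → β) (l L : ℕ) (v : Fin L → β) : ℕ → β := fun i =>
  if i < l then z i else if h : i - l < L then v ⟨i - l, h⟩ else z i

lemma symGlue_lt (z : ℕ → β) (l L : ℕ) (v : Fin L → β) {i : ℕ} (hi : i < l) :
    symGlue z l L v i = z i := by simp [symGlue, hi]

lemma symGlue_add (z : ℕ → β) (l L : ℕ) (v : Fin L → β) (i : Fin L) :
    symGlue z l L v (l + i) = v i := by simp [symGlue]

lemma mem_cyl_glue (z : ℕ → β) (l L : ℕ) (v : Fin L → β) (w : ℕ → β) :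
    w ∈ cylinder (symGlue z l L v) (l + L) ↔
      (∀ i < l, w i = z i) ∧ (fun i : Fin L => w (l + i)) = v := by
  constructor
  · intro h
    refine ⟨fun i hi => ?_, ?_⟩
    · rw [h i (by omega), symGlue_lt _ _ _ _ hi]
    · funext i
      rw [h (l + i) (by omega), symGlue_add]
  · rintro ⟨h1, rfl⟩ i hi
    by_cases hil : i < l
    · rw [h1 i hil, symGlue_lt _ _ _ _ hil]
    · obtain ⟨j, rfl⟩ := Nat.exists_eq_add_of_le (not_lt.1 hil)
      exact (symGlue_add z l L (fun i : Fin L => w (l + i)) ⟨j, by omega⟩).symm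

lemma symShape_eq (z : ℕ → β) (l L : ℕ) (pat : Finset (Fin L → β)) :
    SymShape z l L pat = ⋃ v ∈ pat, cylinder (symGlue z l L v) (l + L) := by
  ext w
  simp only [Set.mem_iUnion, mem_cyl_glue, SymShape, Set.mem_ofPred_eq, exists_prop]
  constructor
  · rintro ⟨h1, h2⟩; exact ⟨_, h2, h1, rfl⟩
  · rintro ⟨v, h2, h1, rfl⟩; exact ⟨h1, h2⟩

lemma measurableSet_symShape (z : ℕ → β) (l L : ℕ) (pat : Finset (Fin L → β)) :
    MeasurableSet (SymShape z l L pat) := by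
  rw [symShape_eq]
  exact Finset.measurableSet_biUnion _ fun v _ => measurableSet_cyl _ _

/-- relative mass of a pattern -/
def symVal (q : β → ℝ) {L : ℕ} (pat : Finset (Fin L → β)) : ℝ := ∑ v ∈ pat, ∏ i, q (v i)

lemma measure_symShape {q : β → ℝ} {ν : Measure (ℕ → β)} [IsProbabilityMeasure ν]
    (hν : ∀ z l, ν.real (cylinder z l) = SymW q z l)
    (z : ℕ → β) (l L : ℕ) (pat : Finset (Fin L → β)) :
    ν.real (SymShape z l L pat) = SymW q z l * symVal q pat := by
  rw [symShape_eq, measureReal_biUnion_finset]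
  · rw [symVal, Finset.mul_sum]
    refine Finset.sum_congr rfl fun v _ => ?_
    rw [hν, SymW, Finset.prod_range_add, SymW]
    congr 1
    · exact Finset.prod_congr rfl fun i hi => by rw [symGlue_lt _ _ _ _ (Finset.mem_range.1 hi)]
    · rw [Finset.prod_range]
      exact Finset.prod_congr rfl fun i _ => by rw [symGlue_add]
  · intro v _ v' _ hne
    refine Set.disjoint_left.2 fun w h1 h2 => hne ?_
    rw [mem_cyl_glue] at h1 h2
    rw [← h1.2, h2.2]
  · intro v _
    exact measurableSet_cyl _ _

end Meas

section Geom
open PiNat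
open MeasureTheory hiding cylinder

variable {α β : Type} [Fintype α] [Fintype β] [Nontrivial α]

/-- length of the longest common prefix of the image of a cylinder -/
def symEll (e : (ℕ → α) ≃ (ℕ → β)) (x : ℕ → α) (k : ℕ) : ℕ :=
  sSup {l | ∀ y ∈ cylinder x k, ∀ y' ∈ cylinder x k, ∀ i < l, e y i = e y' i}

lemma symEll_congr (e : (ℕ → α) ≃ (ℕ → β)) {x y : ℕ → α} {k : ℕ} (h : y ∈ cylinder x k) :
    symEll e y k = symEll e x k := by
  unfold symEll
  rw [mem_cylinder_iff_eq.1 h]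

lemma exists_flip (x : ℕ → α) (k : ℕ) : ∃ y ∈ cylinder x k, x ≠ y ∧ firstDiff x y = k := by
  classical
  obtain ⟨j, hj⟩ := exists_ne (x k)
  have h1 : x ≠ Function.update x k j := fun h => hj (by
    have := congrFun h k
    simpa using this.symm)
  refine ⟨Function.update x k j, update_mem_cylinder x k j, h1, ?_⟩
  apply le_antisymm
  · by_contra hlt
    have := apply_eq_of_lt_firstDiff (not_le.1 hlt)
    simp at this
    exact hj this.symm
  · rw [← mem_cylinder_iff_le_firstDiff h1]
    rw [mem_cylinder_comm]
    exact update_mem_cylinder x k j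

lemma symEll_bdd (e : (ℕ → α) ≃ (ℕ → β)) (x : ℕ → α) (k : ℕ) :
    BddAbove {l | ∀ y ∈ cylinder x k, ∀ y' ∈ cylinder x k, ∀ i < l, e y i = e y' i} := by
  obtain ⟨y, hy, hne, _⟩ := exists_flip x k
  have hne' : e x ≠ e y := fun h => hne (e.injective h)
  refine ⟨firstDiff (e x) (e y), fun l hl => ?_⟩
  by_contra hlt
  exact apply_firstDiff_ne hne' (hl x (self_mem_cylinder _ _) y hy _ (not_le.1 hlt))

lemma symEll_spec (e : (ℕ → α) ≃ (ℕ → β)) {x y y' : ℕ → α} {k i : ℕ}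
    (hy : y ∈ cylinder x k) (hy' : y' ∈ cylinder x k) (hi : i < symEll e x k) : e y i = e y' i := by
  have := Nat.sSup_mem (s := {l | ∀ y ∈ cylinder x k, ∀ y' ∈ cylinder x k, ∀ i < l, e y i = e y' i})
    ⟨0, by simp⟩ (symEll_bdd e x k)
  exact this y hy y' hy' i hi

variable {ρ : α → ℝ} {τ : β → ℝ} {e : (ℕ → α) ≃ (ℕ → β)} {C : ℝ}

lemma symEll_upper (hρ : ∀ i, ρ i ∈ Set.Ioo (0:ℝ) 1) (hC : 0 < C) (h : SymBL ρ τ e C)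
    (x : ℕ → α) (k : ℕ) : SymW τ (e x) (symEll e x k) ≤ C * SymW ρ x k := by
  have hnot : ¬ ∀ y ∈ cylinder x k, ∀ y' ∈ cylinder x k, ∀ i < symEll e x k + 1, e y i = e y' i := by
    intro hh
    have := le_csSup (symEll_bdd e x k) hh
    change symEll e x k + 1 ≤ symEll e x k at this
    omega
  push Not at hnot
  obtain ⟨y, hy, y', hy', i, hi, hne⟩ := hnot
  have hi' : i = symEll e x k := by
    by_contra hh
    exact hne (symEll_spec e hy hy' (by omega))
  subst hi'
  have hyy : y ≠ y' := fun hh => hne (by rw [hh])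
  have hee : e y ≠ e y' := fun hh => hne (by rw [hh])
  have hfd : firstDiff (e y) (e y') = symEll e x k := by
    apply le_antisymm
    · by_contra hlt
      exact hne (apply_eq_of_lt_firstDiff (not_le.1 hlt))
    · by_contra hlt
      exact apply_firstDiff_ne hee (symEll_spec e hy hy' (not_le.1 hlt))
  have h1 := (h y y' hyy).2
  rw [hfd] at h1
  have h2 : k ≤ firstDiff y y' := by
    rw [← mem_cylinder_iff_le_firstDiff hyy, mem_cylinder_iff_eq, mem_cylinder_iff_eq.1 hy,
      mem_cylinder_iff_eq.1 hy']
  have h3 := symW_anti hρ y h2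
  rw [symW_congr τ (y := e y) fun i hi => symEll_spec e (self_mem_cylinder x k) hy hi]
  rw [symW_congr ρ (x := x) (y := y) fun i hi => (hy i hi).symm]
  exact h1.trans (mul_le_mul_of_nonneg_left h3 hC.le)

lemma symEll_lower (hτ : ∀ i, τ i ∈ Set.Ioo (0:ℝ) 1) (hC : 0 < C) (h : SymBL ρ τ e C)
    (x : ℕ → α) (k : ℕ) : SymW ρ x k ≤ C * SymW τ (e x) (symEll e x k) := by
  obtain ⟨y, hy, hne, hfd⟩ := exists_flip x k
  have h1 := (h x y hne).1
  rw [hfd] at h1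
  refine h1.trans (mul_le_mul_of_nonneg_left (symW_anti hτ _ ?_) hC.le)
  by_contra hlt
  exact apply_firstDiff_ne (fun hh => hne (e.injective hh))
    (symEll_spec e (self_mem_cylinder x k) hy (not_le.1 hlt))

lemma exists_det (hρ : ∀ i, ρ i ∈ Set.Ioo (0:ℝ) 1) (hτ : ∀ i, τ i ∈ Set.Ioo (0:ℝ) 1) (hC : 0 < C)
    (h : SymBL ρ τ e C) :
    ∃ L : ℕ, ∀ x k y, y ∈ cylinder x k → ∀ w : ℕ → β, (∀ i < symEll e x k + L, w i = e y i) →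
      e.symm w ∈ cylinder y (k+1) := by
  obtain ⟨a, ha0, ha⟩ := exists_min_pos (fun i => (hρ i).1)
  obtain ⟨b, hb0, hb1, hb⟩ := exists_max_lt hτ
  obtain ⟨L, hL⟩ : ∃ L : ℕ, C * C * b ^ L < a := by
    have h2 : Filter.Tendsto (fun k : ℕ => C * C * b ^ k) Filter.atTop (nhds (C * C * 0)) :=
      (tendsto_pow_atTop_nhds_zero_of_lt_one hb0.le hb1).const_mul _
    rw [mul_zero] at h2
    exact (h2.eventually (gt_mem_nhds ha0)).exists
  refine ⟨L, fun x k y hy w hw => ?_⟩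
  by_contra hcon
  rw [← symEll_congr e hy] at hw
  set y' := e.symm w with hy'
  have hne : y ≠ y' := by
    rintro hh
    rw [← hh] at hcon
    exact hcon (self_mem_cylinder _ _)
  have hfd : firstDiff y y' ≤ k + 1 := by
    by_contra hlt
    apply hcon
    rw [mem_cylinder_comm, mem_cylinder_iff_le_firstDiff hne]
    omega
  have hw' : w = e y' := by simp [hy']
  have hfd2 : symEll e y k + L ≤ firstDiff (e y) (e y') := by
    rw [← mem_cylinder_iff_le_firstDiff (fun hh => hne (e.injective hh)), mem_cylinder_comm, ← hw']
    exact hw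
  have h1 := symW_anti hρ y hfd
  have h2 := (h y y' hne).1
  have h3 := symW_anti hτ (e y) hfd2
  have h4 := symW_add_le hτ hb (e y) (symEll e y k) L
  have h5 := symEll_upper hρ hC h y k
  rw [symW_succ] at h1
  have h6 := symW_pos hρ y k
  have h7 : SymW ρ y k * a ≤ SymW ρ y k * (C * C * b ^ L) := by
    calc SymW ρ y k * a ≤ SymW ρ y k * ρ (y k) := mul_le_mul_of_nonneg_left (ha _) h6.le
      _ ≤ _ := h1
      _ ≤ _ := h2
      _ ≤ C * (SymW τ (e y) (symEll e y k) * b ^ L) := mul_le_mul_of_nonneg_left (h3.trans h4) hC.le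
      _ ≤ C * ((C * SymW ρ y k) * b ^ L) := by gcongr
      _ = _ := by ring
  have := le_of_mul_le_mul_left h7 h6
  linarith

lemma exists_shape {L : ℕ} (hL : ∀ x k y, y ∈ cylinder x k → ∀ w : ℕ → β,
      (∀ i < symEll e x k + L, w i = e y i) → e.symm w ∈ cylinder y (k+1))
    (x y : ℕ → α) (k k' : ℕ) (hy : y ∈ cylinder x k) (hk : k' = k ∨ k' = k + 1) :
    ∃ pat : Finset (Fin L → β), pat.Nonempty ∧
      e '' cylinder y k' = SymShape (e x) (symEll e x k) L pat := by
  classical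
  have hsub : cylinder y k' ⊆ cylinder x k := by
    rw [← mem_cylinder_iff_eq.1 hy]
    exact cylinder_anti _ (by omega)
  refine ⟨Finset.univ.filter fun v => ∃ y' ∈ cylinder y k', ∀ i : Fin L, e y' (symEll e x k + i) = v i,
    ⟨fun i => e y (symEll e x k + i), ?_⟩, ?_⟩
  · simp only [Finset.mem_filter, Finset.mem_univ, true_and]
    exact ⟨y, self_mem_cylinder _ _, fun i => rfl⟩
  ext w
  simp only [SymShape, Set.mem_ofPred_eq, Finset.mem_filter, Finset.mem_univ, true_and]
  constructor
  · rintro ⟨y', hy', rfl⟩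
    exact ⟨fun i hi => symEll_spec e (hsub hy') (self_mem_cylinder x k) hi, y', hy', fun i => rfl⟩
  · rintro ⟨h1, y', hy', h2⟩
    have h3 := hL x k y' (hsub hy') w ?_
    · refine ⟨e.symm w, ?_, by simp⟩
      have h4 : e.symm w ∈ cylinder y' k' := cylinder_anti _ (by omega) h3
      rwa [mem_cylinder_iff_eq.1 hy'] at h4
    · intro i hi
      by_cases hil : i < symEll e x k
      · rw [h1 i hil]
        exact symEll_spec e (self_mem_cylinder x k) (hsub hy') hil
      · obtain ⟨j, rfl⟩ := Nat.exists_eq_add_of_le (not_lt.1 hil)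
        exact (h2 ⟨j, by omega⟩).symm

variable [MeasurableSpace β] [MeasurableSingletonClass β]

lemma measure_add [DecidableEq α] {L : ℕ} (hL : ∀ x k y, y ∈ cylinder x k → ∀ w : ℕ → β,
      (∀ i < symEll e x k + L, w i = e y i) → e.symm w ∈ cylinder y (k+1))
    (ν : Measure (ℕ → β)) [IsProbabilityMeasure ν] (x : ℕ → α) (k : ℕ) :
    ν.real (e '' cylinder x k) = ∑ j, ν.real (e '' cylinder (Function.update x k j) (k+1)) := by
  have h1 : e '' cylinder x k = ⋃ j ∈ (Finset.univ : Finset α),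
      e '' cylinder (Function.update x k j) (k+1) := by
    rw [← iUnion_cylinder_update x k, Set.image_iUnion]
    simp
  rw [h1, measureReal_biUnion_finset]
  · intro j _ j' _ hne
    refine (Set.disjoint_image_iff e.injective).2 (Set.disjoint_left.2 fun w h1 h2 => hne ?_)
    have a1 := h1 k (by omega)
    have a2 := h2 k (by omega)
    simp at a1 a2
    rw [← a1, a2]
  · intro j _
    obtain ⟨pat, _, hp⟩ := exists_shape hL x (Function.update x k j) k (k+1) (update_mem_cylinder _ _ _)
      (Or.inr rfl)
    rw [hp]
    exact measurableSet_symShape _ _ _ _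

lemma measure_le_ell {q : β → ℝ} (ν : Measure (ℕ → β)) [IsProbabilityMeasure ν]
    (hν : ∀ z l, ν.real (cylinder z l) = SymW q z l) (x : ℕ → α) (k : ℕ) :
    ν.real (e '' cylinder x k) ≤ SymW q (e x) (symEll e x k) := by
  rw [← hν]
  refine measureReal_mono ?_
  rintro _ ⟨y, hy, rfl⟩ i hi
  exact symEll_spec e hy (self_mem_cylinder _ _) hi

end Geom

section DimLe
open PiNat
open MeasureTheory hiding cylinder
variable {α β : Type} [Fintype α] [Fintype β] [Nontrivial α]
variable {ρ : α → ℝ} {τ : β → ℝ} {e : (ℕ → α) ≃ (ℕ → β)} {C : ℝ}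

lemma dim_le (hρ : ∀ i, ρ i ∈ Set.Ioo (0:ℝ) 1) (hτ : ∀ i, τ i ∈ Set.Ioo (0:ℝ) 1) (hC : 0 < C)
    (h : SymBL ρ τ e C) {s t : ℝ} (hs : 0 < s) (ht : 0 < t) (hss : ∑ i, ρ i ^ s = 1)
    (htt : ∑ i, τ i ^ t = 1) : t ≤ s := by
  classical
  by_contra hlt
  push Not at hlt
  let _ : MeasurableSpace β := ⊤
  have _ : MeasurableSingletonClass β := ⟨fun _ => trivial⟩
  obtain ⟨L, hL⟩ := exists_det hρ hτ hC h
  obtain ⟨ν, hνp, hν⟩ := exists_measure (q := fun i => τ i ^ t) (rpow_mem_Ioo hτ ht) htt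
  have key : ∀ k, ∃ x : ℕ → α, SymW ρ x k ^ s ≤ ν.real (e '' cylinder x k) := by
    intro k
    induction k with
    | zero =>
      refine ⟨fun _ => Classical.arbitrary α, ?_⟩
      rw [symW_zero, Real.one_rpow, cylinder_zero, Set.image_univ, e.surjective.range_eq]
      simp
    | succ k ih =>
      obtain ⟨x, hx⟩ := ih
      rw [measure_add hL ν x k] at hx
      have h1 : SymW ρ x k ^ s = ∑ j, SymW ρ (Function.update x k j) (k+1) ^ s := by
        rw [← mul_one (SymW ρ x k ^ s), ← hss, Finset.mul_sum]
        refine Finset.sum_congr rfl fun j _ => ?_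
        rw [symW_succ, Real.mul_rpow (symW_pos hρ _ _).le (hρ _).1.le]
        simp only [Function.update_self]
        rw [symW_congr ρ (x := Function.update x k j) (y := x)]
        intro i hi
        exact Function.update_of_ne (by omega) _ _
      rw [h1] at hx
      obtain ⟨j, _, hj⟩ := Finset.exists_le_of_sum_le Finset.univ_nonempty hx
      exact ⟨_, hj⟩
  obtain ⟨b, hb0, hb1, hb⟩ := exists_max_lt hρ
  have h2 : ∀ k : ℕ, 1 ≤ C ^ t * (b ^ (t - s)) ^ k := by
    intro k
    obtain ⟨x, hx⟩ := key k
    have h3 := hx.trans (measure_le_ell ν hν x k)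
    rw [symW_rpow hτ] at h3
    have hR := symW_pos hρ x k
    have h4 : SymW τ (e x) (symEll e x k) ^ t ≤ (C * SymW ρ x k) ^ t :=
      Real.rpow_le_rpow (symW_pos hτ _ _).le (symEll_upper hρ hC h x k) ht.le
    rw [Real.mul_rpow hC.le hR.le] at h4
    have h5 : SymW ρ x k ^ t = SymW ρ x k ^ s * SymW ρ x k ^ (t - s) := by
      rw [← Real.rpow_add hR]; congr 1; ring
    have h6 : SymW ρ x k ^ (t - s) ≤ (b ^ (t-s)) ^ k := by
      have h7 := symW_add_le hρ hb x 0 k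
      rw [symW_zero, zero_add, one_mul] at h7
      rw [← Real.rpow_natCast, ← Real.rpow_mul hb0.le, mul_comm, Real.rpow_mul hb0.le, Real.rpow_natCast]
      exact Real.rpow_le_rpow hR.le h7 (by linarith)
    have h8 : 0 < SymW ρ x k ^ s := Real.rpow_pos_of_pos hR s
    have h9 : 0 < C ^ t := Real.rpow_pos_of_pos hC t
    have h10 : SymW ρ x k ^ s * 1 ≤ SymW ρ x k ^ s * (C ^ t * (b ^ (t - s)) ^ k) := by
      calc SymW ρ x k ^ s * 1 ≤ C ^ t * (SymW ρ x k ^ s * SymW ρ x k ^ (t - s)) := by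
            rw [mul_one, ← h5]; exact h3.trans h4
        _ ≤ C ^ t * (SymW ρ x k ^ s * (b ^ (t-s)) ^ k) := by gcongr
        _ = _ := by ring
    exact le_of_mul_le_mul_left h10 h8
  have hb2 : b ^ (t - s) < 1 := Real.rpow_lt_one hb0.le hb1 (by linarith)
  have h3 : Filter.Tendsto (fun k : ℕ => C ^ t * (b ^ (t - s)) ^ k) Filter.atTop (nhds (C ^ t * 0)) :=
      (tendsto_pow_atTop_nhds_zero_of_lt_one (Real.rpow_nonneg hb0.le _) hb2).const_mul _
  have := ge_of_tendsto' h3 h2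
  rw [mul_zero] at this
  linarith

end DimLe

section Core
open PiNat
open MeasureTheory hiding cylinder
variable {α β : Type} [Fintype α] [Fintype β] [Nontrivial α]
variable {e : (ℕ → α) ≃ (ℕ → β)}

/-- the measure-linearity conclusion -/
def SymCore (p : α → ℝ) (q : β → ℝ) (e : (ℕ → α) ≃ (ℕ → β)) : Prop :=
  ∃ (x0 : ℕ → α) (k0 : ℕ) (c : ℝ) (L : ℕ), 0 < c ∧ ∀ x ∈ cylinder x0 k0, ∀ k, k0 ≤ k →
    ∃ pat : Finset (Fin L → β), 0 < symVal q pat ∧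
      e '' cylinder x k = SymShape (e x) (symEll e x k) L pat ∧
      c * SymW p x k = SymW q (e x) (symEll e x k) * symVal q pat

lemma symVal_pos {q : β → ℝ} (hq : ∀ i, q i ∈ Set.Ioo (0:ℝ) 1) {L : ℕ} {pat : Finset (Fin L → β)}
    (h : pat.Nonempty) : 0 < symVal q pat :=
  Finset.sum_pos (fun v _ => Finset.prod_pos fun i _ => (hq _).1) h

lemma symCore_of_BL {ρ : α → ℝ} {τ : β → ℝ} {C : ℝ}
    (hρ : ∀ i, ρ i ∈ Set.Ioo (0:ℝ) 1) (hτ : ∀ i, τ i ∈ Set.Ioo (0:ℝ) 1) (hC : 0 < C)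
    (h : SymBL ρ τ e C) {s : ℝ} (hs : 0 < s) (hss : ∑ i, ρ i ^ s = 1)
    (htt : ∑ i, τ i ^ s = 1) : SymCore (fun i => ρ i ^ s) (fun i => τ i ^ s) e := by
  classical
  let _ : MeasurableSpace β := ⊤
  have _ : MeasurableSingletonClass β := ⟨fun _ => trivial⟩
  obtain ⟨L, hL⟩ := exists_det hρ hτ hC h
  set p : α → ℝ := fun i => ρ i ^ s with hp_def
  set q : β → ℝ := fun i => τ i ^ s with hq_def
  have hp : ∀ i, p i ∈ Set.Ioo (0:ℝ) 1 := rpow_mem_Ioo hρ hs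
  have hq : ∀ i, q i ∈ Set.Ioo (0:ℝ) 1 := rpow_mem_Ioo hτ hs
  obtain ⟨ν, hνp, hν⟩ := exists_measure (q := q) hq htt
  let g : (ℕ → α) → ℕ → ℝ := fun x k => ν.real (e '' cylinder x k) / SymW p x k
  have hνg : ∀ x k, ν.real (e '' cylinder x k) = g x k * SymW p x k := fun x k =>
    (div_mul_cancel₀ _ (symW_pos hp x k).ne').symm
  have hgpos : ∀ x k, 0 < g x k := by
    intro x k
    obtain ⟨pat, hne, hpat⟩ := exists_shape hL x x k k (self_mem_cylinder _ _) (Or.inl rfl)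
    refine div_pos ?_ (symW_pos hp x k)
    rw [hpat, measure_symShape hν]
    exact mul_pos (symW_pos hq _ _) (symVal_pos hq hne)
  have hgle : ∀ x k, g x k ≤ C ^ s := by
    intro x k
    rw [div_le_iff₀ (symW_pos hp x k)]
    refine (measure_le_ell ν hν x k).trans ?_
    rw [symW_rpow hτ, symW_rpow hρ, ← Real.mul_rpow hC.le (symW_pos hρ _ _).le]
    exact Real.rpow_le_rpow (symW_pos hτ _ _).le (symEll_upper hρ hC h x k) hs.le
  let I := Finset (Fin L → β) × Finset (Fin L → β) × α
  let r : I → ℝ := fun t => symVal q t.2.1 / (symVal q t.1 * p t.2.2)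
  have hratio : ∀ x k y, y ∈ cylinder x k → ∃ t : I, g y (k+1) = g x k * r t := by
    intro x k y hy
    obtain ⟨pat, hne, hpat⟩ := exists_shape hL x x k k (self_mem_cylinder _ _) (Or.inl rfl)
    obtain ⟨pat', hne', hpat'⟩ := exists_shape hL x y k (k+1) hy (Or.inr rfl)
    refine ⟨(pat, pat', y k), ?_⟩
    simp only [g, r]
    rw [hpat, hpat', measure_symShape hν, measure_symShape hν, symW_succ,
      symW_congr p (x := y) (y := x) hy]
    have h1 := symW_pos hp x k
    have h2 := (hp (y k)).1
    have h3 := symVal_pos hq hne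
    field_simp
  obtain ⟨δ, hδ, hδr⟩ : ∃ δ : ℝ, 0 < δ ∧ ∀ t : I, 1 < r t → 1 + δ ≤ r t := by
    obtain ⟨δ, hδ, hle⟩ := exists_min_pos (p := fun t : I => if 1 < r t then r t - 1 else 1)
      (by intro t; split_ifs with h1
          · linarith
          · exact one_pos)
    refine ⟨δ, hδ, fun t ht => ?_⟩
    have := hle t
    simp only [ht, if_true] at this
    linarith
  have hbdd : BddAbove (Set.range fun t : (ℕ → α) × ℕ => g t.1 t.2) :=
    ⟨C ^ s, by rintro _ ⟨t, rfl⟩; exact hgle _ _⟩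
  set M := sSup (Set.range fun t : (ℕ → α) × ℕ => g t.1 t.2) with hM
  have hgM : ∀ x k, g x k ≤ M := fun x k => le_csSup hbdd ⟨(x, k), rfl⟩
  have hMpos : 0 < M := lt_of_lt_of_le (hgpos (fun _ => Classical.arbitrary α) 0) (hgM _ _)
  have hlt : M / (1 + δ) < M := div_lt_self hMpos (by linarith)
  obtain ⟨_, ⟨⟨x0, k0⟩, rfl⟩, hx0⟩ := exists_lt_of_lt_csSup (Set.range_nonempty _) hlt
  simp only at hx0
  rw [div_lt_iff₀ (by linarith)] at hx0
  have hconst : ∀ n, ∀ x ∈ cylinder x0 k0, g x (k0 + n) = g x0 k0 := by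
    intro n
    induction n with
    | zero =>
      intro x hx
      simp only [g, add_zero]
      rw [mem_cylinder_iff_eq.1 hx, symW_congr p (x := x) (y := x0) hx]
    | succ n ih =>
      intro x hx
      have hle : ∀ y ∈ cylinder x (k0 + n), g y (k0 + n + 1) ≤ g x0 k0 := by
        intro y hy
        obtain ⟨t, ht⟩ := hratio x (k0 + n) y hy
        rw [ih x hx] at ht
        by_contra hcon
        have h1 : 1 < r t := by
          by_contra h2
          have := hgpos x0 k0
          nlinarith
        have h2 := hδr t h1
        have h3 := hgM y (k0 + n + 1)
        have := hgpos x0 k0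
        nlinarith
      have hadd := measure_add hL ν x (k0 + n)
      rw [hνg, ih x hx] at hadd
      have hPj : ∀ j, SymW p (Function.update x (k0 + n) j) (k0 + n + 1) = SymW p x (k0+n) * p j := by
        intro j
        rw [symW_succ]
        simp only [Function.update_self]
        rw [symW_congr p (x := Function.update x (k0+n) j) (y := x)]
        intro i hi
        exact Function.update_of_ne (by omega) _ _
      have hsum : ∑ j, ν.real (e '' cylinder (Function.update x (k0+n) j) (k0 + n + 1)) =
          ∑ j, g x0 k0 * (SymW p x (k0+n) * p j) := by
        rw [← hadd, ← Finset.mul_sum, ← Finset.mul_sum, hss, mul_one]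
      have hterm : ∀ j ∈ Finset.univ, ν.real (e '' cylinder (Function.update x (k0+n) j) (k0 + n + 1)) ≤
          g x0 k0 * (SymW p x (k0+n) * p j) := by
        intro j _
        rw [hνg, hPj]
        exact mul_le_mul_of_nonneg_right (hle _ (update_mem_cylinder _ _ _))
          (mul_pos (symW_pos hp _ _) (hp j).1).le
      have heq := (Finset.sum_eq_sum_iff_of_le hterm).1 hsum (x (k0 + n)) (Finset.mem_univ _)
      rw [hνg, hPj, Function.update_eq_self] at heq
      exact mul_right_cancel₀ (mul_pos (symW_pos hp _ _) (hp _).1).ne' heq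
  refine ⟨x0, k0, g x0 k0, L, hgpos _ _, ?_⟩
  intro x hx k hk
  obtain ⟨n, rfl⟩ := Nat.exists_eq_add_of_le hk
  obtain ⟨pat, hne, hpat⟩ := exists_shape hL x x (k0+n) (k0+n) (self_mem_cylinder _ _) (Or.inl rfl)
  refine ⟨pat, symVal_pos hq hne, hpat, ?_⟩
  rw [← measure_symShape hν, ← hpat, hνg, hconst n x hx]

lemma prod_letters {ι : Type*} (q : β → ℝ) [DecidableEq β] (S : Finset ι) (z : ι → β) :
    ∏ t ∈ S, q (z t) = ∏ j, q j ^ (S.filter fun t => z t = j).card := by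
  rw [← Finset.prod_fiberwise S z]
  refine Finset.prod_congr rfl fun j _ => ?_
  rw [Finset.prod_congr rfl (g := fun _ => q j), Finset.prod_const]
  intro t ht
  rw [(Finset.mem_filter.1 ht).2]

lemma semigroup_of_core {p : α → ℝ} {q : β → ℝ} (hp : ∀ i, p i ∈ Set.Ioo (0:ℝ) 1)
    (hq : ∀ i, q i ∈ Set.Ioo (0:ℝ) 1) (h : SymCore p q e) (i : α) :
    ∃ N : ℕ, 0 < N ∧ ∃ b : β → ℕ, p i ^ N = ∏ j, q j ^ b j := by
  classical
  obtain ⟨x0, k0, c, L, hc, hcore⟩ := h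
  let x : ℕ → α := fun t => if t < k0 then x0 t else i
  have hx : x ∈ cylinder x0 k0 := fun t ht => by simp [x, ht]
  choose pat hpos _ heq using fun k : ℕ => hcore x hx (k0 + k) (by omega)
  have hP : ∀ k, SymW p x (k0 + k) = SymW p x k0 * p i ^ k := by
    intro k
    rw [SymW, Finset.prod_range_add, SymW]
    congr 1
    simp [x]
  obtain ⟨k, k', hne, hkk⟩ := Finite.exists_ne_map_eq_of_infinite pat
  wlog hlt : k < k' generalizing k k'
  · exact this k' k hne.symm hkk.symm (by omega)
  have e1 := heq k
  have e2 := heq k'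
  rw [hP] at e1 e2
  rw [← hkk] at e2
  set l := symEll e x (k0 + k)
  set l' := symEll e x (k0 + k')
  obtain ⟨N, rfl⟩ := Nat.exists_eq_add_of_lt hlt
  have hv := hpos k
  set v := symVal q (pat k)
  have hpi := (hp i).1
  have e3 : SymW q (e x) l' = SymW q (e x) l * p i ^ (N+1) := by
    apply mul_right_cancel₀ hv.ne'
    rw [← e2, mul_right_comm, ← e1]
    ring
  have hQ := symW_pos hq (e x) l
  have hll : l ≤ l' := by
    by_contra hcon
    have h1 := symW_anti hq (e x) (not_le.1 hcon).le
    have h2 : p i ^ (N+1) < 1 := pow_lt_one₀ hpi.le (hp i).2 (by omega)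
    nlinarith
  obtain ⟨D, hD⟩ := Nat.exists_eq_add_of_le hll
  refine ⟨N+1, by omega, fun j => ((Finset.range D).filter fun t => e x (l + t) = j).card, ?_⟩
  refine Eq.trans ?_ (prod_letters q (Finset.range D) (fun t => e x (l + t)))
  rw [hD, SymW, Finset.prod_range_add] at e3
  exact (mul_left_cancel₀ hQ.ne' e3).symm

lemma exists_dual {ι : Type} [DecidableEq ι] {v : ι → ℝ} (hv : LinearIndependent ℚ v) (i : ι) :
    ∃ ψ : ℝ →ₗ[ℚ] ℚ, ∀ k, ψ (v k) = if k = i then 1 else 0 := by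
  obtain ⟨g, hg⟩ := LinearMap.exists_extend ((Finsupp.lapply i).comp hv.repr)
  refine ⟨g, fun k => ?_⟩
  have h1 : v k ∈ Submodule.span ℚ (Set.range v) := Submodule.subset_span ⟨k, rfl⟩
  have h2 := LinearMap.congr_fun hg ⟨v k, h1⟩
  simp only [LinearMap.comp_apply, Submodule.subtype_apply] at h2
  rw [h2]
  have h3 : hv.repr ⟨v k, h1⟩ = Finsupp.single k 1 := hv.repr_eq_single k _ rfl
  simp [h3, Finsupp.single_apply]

lemma commensurable {p : α → ℝ} {q : β → ℝ} (hp : ∀ i, p i ∈ Set.Ioo (0:ℝ) 1)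
    (hq : ∀ i, q i ∈ Set.Ioo (0:ℝ) 1) (hind : LinearIndependent ℚ fun i => Real.log (p i))
    (h1 : ∀ i, ∃ N : ℕ, 0 < N ∧ ∃ b : β → ℕ, p i ^ N = ∏ j, q j ^ b j)
    (h2 : ∀ j, ∃ N : ℕ, 0 < N ∧ ∃ b : α → ℕ, q j ^ N = ∏ i, p i ^ b i) (i : α) :
    ∃ (j : β) (a b : ℕ), 0 < a ∧ 0 < b ∧ p i ^ a = q j ^ b := by
  classical
  obtain ⟨N, hN, b, hb⟩ := h1 i
  choose N' hN' b' hb' using h2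
  obtain ⟨j, hj⟩ : ∃ j, 0 < b j := by
    by_contra hcon
    push Not at hcon
    have : p i ^ N = 1 := by
      rw [hb]
      exact Finset.prod_eq_one fun j _ => by rw [Nat.le_zero.1 (hcon j), pow_zero]
    exact (pow_lt_one₀ (hp i).1.le (hp i).2 hN.ne').ne this
  have hz : ∀ i', i' ≠ i → b' j i' = 0 := by
    intro i' hi'
    obtain ⟨ψ, hψ⟩ := exists_dual hind i'
    have f1 : ∀ j, (N' j : ℚ) * ψ (Real.log (q j)) = b' j i' := by
      intro j
      have := congrArg (fun t => ψ (Real.log t)) (hb' j)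
      rw [Real.log_pow, Real.log_prod (fun i _ => (pow_pos (hp i).1 _).ne'), map_sum] at this
      simp only [Real.log_pow, ← nsmul_eq_mul, map_nsmul, hψ] at this
      simpa using this
    have f2 : ∑ j, (b j : ℚ) * ψ (Real.log (q j)) = 0 := by
      have := congrArg (fun t => ψ (Real.log t)) hb
      rw [Real.log_pow, Real.log_prod (fun i _ => (pow_pos (hq i).1 _).ne'), map_sum] at this
      simp only [Real.log_pow, ← nsmul_eq_mul, map_nsmul, hψ, hi'.symm, if_false] at this
      simpa using this.symm
    have f3 : ∀ j, 0 ≤ ψ (Real.log (q j)) := by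
      intro j
      have hpos : (0:ℚ) < N' j := by exact_mod_cast hN' j
      have : (0:ℚ) ≤ N' j * ψ (Real.log (q j)) := by rw [f1]; positivity
      exact nonneg_of_mul_nonneg_right this hpos
    have f4 := (Finset.sum_eq_zero_iff_of_nonneg (fun j _ => mul_nonneg (Nat.cast_nonneg _) (f3 j))).1 f2 j
      (Finset.mem_univ _)
    have hbj : (b j : ℚ) ≠ 0 := by exact_mod_cast hj.ne'
    have f5 := f1 j
    rw [(mul_eq_zero.1 f4).resolve_left hbj, mul_zero] at f5
    exact_mod_cast f5.symm
  have hfin := hb' j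
  rw [Finset.prod_eq_single i (fun i' _ hi' => by rw [hz i' hi', pow_zero])
    (fun h => absurd (Finset.mem_univ _) h)] at hfin
  refine ⟨j, b' j i, N' j, ?_, hN' j, hfin.symm⟩
  by_contra hcon
  rw [Nat.le_zero.1 (not_lt.1 hcon), pow_zero] at hfin
  exact (pow_lt_one₀ (hq j).1.le (hq j).2 (hN' j).ne').ne hfin

end Core

section Count
open PiNat
variable {α β : Type} [Fintype α] [Fintype β] [Nontrivial α]
variable {e : (ℕ → α) ≃ (ℕ → β)}

lemma card_small_subsets {U : Type} [DecidableEq U] (S : Finset U) (K : ℕ) :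
    (S.powerset.filter fun T => T.card ≤ K).card ≤ (K+1) * (S.card + 1) ^ K := by
  have h1 : (S.powerset.filter fun T => T.card ≤ K) ⊆
      (Finset.range (K+1)).biUnion fun k => S.powersetCard k := by
    intro T hT
    rw [Finset.mem_filter, Finset.mem_powerset] at hT
    rw [Finset.mem_biUnion]
    exact ⟨T.card, Finset.mem_range.2 (by omega), Finset.mem_powersetCard.2 ⟨hT.1, rfl⟩⟩
  refine (Finset.card_le_card h1).trans (Finset.card_biUnion_le.trans ?_)
  calc ∑ k ∈ Finset.range (K+1), (S.powersetCard k).card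
      ≤ ∑ k ∈ Finset.range (K+1), (S.card + 1) ^ K := by
        refine Finset.sum_le_sum fun k hk => ?_
        rw [Finset.card_powersetCard]
        calc S.card.choose k ≤ S.card ^ k := Nat.choose_le_pow _ _
          _ ≤ (S.card + 1) ^ k := Nat.pow_le_pow_left (by omega) _
          _ ≤ (S.card + 1) ^ K := Nat.pow_le_pow_right (by omega) (by
            have := Finset.mem_range.1 hk; omega)
    _ = _ := by simp

lemma growth {J K A A' n Z : ℕ}
    (h : ∀ N : ℕ, (N + J).choose J ≤ (A * N + A' + 1) * ((K+1) * ((A * N + A') * n + 1) ^ K * Z)) :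
    J ≤ K + 1 := by
  by_contra hcon
  push Not at hcon
  obtain ⟨i, hi⟩ := Nat.exists_eq_add_of_lt hcon
  set c := J.factorial * ((A + A' + 1) * ((K+1) * ((A + A') * n + 1) ^ K * Z)) with hc
  have h1 : ∀ N : ℕ, (N+1) ^ J ≤ c * (N+1) ^ (K+1) := by
    intro N
    have h2 : (N+1) ^ J ≤ J.factorial * (N + J).choose J := by
      have := Nat.pow_sub_le_descFactorial (N + J) J
      rw [Nat.descFactorial_eq_factorial_mul_choose] at this
      rwa [show N + J + 1 - J = N + 1 by omega] at this
    have h3 : A * N + A' + 1 ≤ (A + A' + 1) * (N+1) := by nlinarith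
    have h4 : (A * N + A') * n + 1 ≤ ((A + A') * n + 1) * (N+1) := by
      have : (A * N + A') * n ≤ ((A + A') * (N + 1)) * n := Nat.mul_le_mul_right _ (by nlinarith)
      nlinarith
    calc (N+1) ^ J ≤ J.factorial * (N + J).choose J := h2
      _ ≤ J.factorial * ((A * N + A' + 1) * ((K+1) * ((A * N + A') * n + 1) ^ K * Z)) :=
        Nat.mul_le_mul_left _ (h N)
      _ ≤ J.factorial * (((A + A' + 1) * (N+1)) * ((K+1) * (((A + A') * n + 1) * (N+1)) ^ K * Z)) := by
        gcongr
      _ = _ := by rw [hc, mul_pow]; ring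
  have h2 := h1 c
  have h3 : (c+1) ^ (K+2) ≤ (c+1) ^ J := Nat.pow_le_pow_right (by omega) (by omega)
  have h4 : 0 < (c+1) ^ (K+1) := by positivity
  have h5 : (c+1) ^ (K+2) = (c+1) * (c+1) ^ (K+1) := by ring
  nlinarith

lemma count_of_core {p : α → ℝ} {q : β → ℝ} (hp : ∀ i, p i ∈ Set.Ioo (0:ℝ) 1)
    (hq : ∀ i, q i ∈ Set.Ioo (0:ℝ) 1) (hind : LinearIndependent ℚ fun j => Real.log (q j))
    (h : SymCore p q e) {i1 i2 : α} (hi : i1 ≠ i2) {j1 j2 : β} {a1 b1 a2 b2 : ℕ}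
    (ha1 : 0 < a1) (ha2 : 0 < a2) (h1 : p i1 ^ a1 = q j1 ^ b1) (h2 : p i2 ^ a2 = q j2 ^ b2) :
    a2 ≤ b2 := by
  classical
  obtain ⟨x0, k0, c, L, hc, hcore⟩ := h
  choose ψ hψ using fun j => exists_dual hind j
  let cnt : (ℕ → β) → ℕ → β → ℕ := fun z l j => ((Finset.range l).filter fun t => z t = j).card
  have hcnt : ∀ z l j, ψ j (Real.log (SymW q z l)) = cnt z l j := by
    intro z l j
    rw [SymW, prod_letters, Real.log_prod (fun i _ => (pow_pos (hq i).1 _).ne'), map_sum]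
    simp only [Real.log_pow, ← nsmul_eq_mul, map_nsmul, hψ]
    simp [cnt]
  -- constants
  obtain ⟨Cst, hCst⟩ : ∃ Cst : ℕ, ∀ t : β × Finset (Fin L → β),
      ψ t.1 (Real.log c + Real.log (SymW p x0 k0)) - ψ t.1 (Real.log (symVal q t.2)) ≤ Cst := by
    obtain ⟨B, hB⟩ := (Set.finite_range fun t : β × Finset (Fin L → β) =>
      ψ t.1 (Real.log c + Real.log (SymW p x0 k0)) - ψ t.1 (Real.log (symVal q t.2))).bddAbove
    obtain ⟨n, hn⟩ := exists_nat_ge B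
    exact ⟨n, fun t => (hB ⟨t, rfl⟩).trans hn⟩
  have hψ1 : ∀ j, ψ j (Real.log (p i1)) = if j1 = j then (b1 : ℚ) / a1 else 0 := by
    intro j
    have := congrArg (fun t => ψ j (Real.log t)) h1
    simp only [Real.log_pow, ← nsmul_eq_mul, map_nsmul, hψ] at this
    have ha : (a1 : ℚ) ≠ 0 := by exact_mod_cast ha1.ne'
    simp only [nsmul_eq_mul] at this
    split_ifs with hj
    · rw [if_pos hj] at this; field_simp; linarith
    · rw [if_neg hj, mul_zero] at this; exact (mul_eq_zero.1 this).resolve_left ha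
  have hψ2 : ∀ j, ψ j (Real.log (p i2)) = if j2 = j then (b2 : ℚ) / a2 else 0 := by
    intro j
    have := congrArg (fun t => ψ j (Real.log t)) h2
    simp only [Real.log_pow, ← nsmul_eq_mul, map_nsmul, hψ] at this
    have ha : (a2 : ℚ) ≠ 0 := by exact_mod_cast ha2.ne'
    simp only [nsmul_eq_mul] at this
    split_ifs with hj
    · rw [if_pos hj] at this; field_simp; linarith
    · rw [if_neg hj, mul_zero] at this; exact (mul_eq_zero.1 this).resolve_left ha
  -- words
  let X : Finset ℕ → ℕ → α := fun B t => if t < k0 then x0 t else if t - k0 ∈ B then i2 else i1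
  have hX : ∀ B, X B ∈ cylinder x0 k0 := fun B t ht => by simp [X, ht]
  have hXW : ∀ N J, ∀ B ∈ (Finset.range (N+J)).powersetCard J,
      SymW p (X B) (k0 + (N + J)) = SymW p x0 k0 * (p i2 ^ J * p i1 ^ N) := by
    intro N J B hB
    rw [Finset.mem_powersetCard] at hB
    rw [SymW, Finset.prod_range_add]
    congr 1
    · exact Finset.prod_congr rfl fun t ht => by rw [hX B t (Finset.mem_range.1 ht)]
    · have : ∀ t, p (X B (k0 + t)) = if t ∈ B then p i2 else p i1 := by
        intro t
        simp only [X]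
        rw [if_neg (by omega), Nat.add_sub_cancel_left]
        split_ifs <;> rfl
      simp only [this]
      rw [Finset.prod_ite, Finset.prod_const, Finset.prod_const, Finset.filter_mem_eq_inter,
        Finset.inter_eq_right.2 hB.1, hB.2]
      congr 2
      rw [Finset.filter_notMem_eq_sdiff, Finset.card_sdiff_of_subset hB.1, hB.2, Finset.card_range]
      omega
  choose pat hpos hshape heq using fun (B : Finset ℕ) (k : ℕ) => hcore (X B) (hX B) (k0 + k) (by omega)
  let ll : Finset ℕ → ℕ → ℕ := fun B k => symEll e (X B) (k0 + k)
  have hbound : ∀ N J, ∀ B ∈ (Finset.range (N+J)).powersetCard J, ∀ j,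
      (cnt (e (X B)) (ll B (N+J)) j : ℚ) ≤
        N * ψ j (Real.log (p i1)) + J * ψ j (Real.log (p i2)) + Cst := by
    intro N J B hB j
    have e1 := heq B (N + J)
    rw [hXW N J B hB] at e1
    have e2 := congrArg (fun t => ψ j (Real.log t)) e1
    have q1 := (hp i1).1
    have q2 := (hp i2).1
    have q3 := symW_pos hp x0 k0
    have q4 := symW_pos hq (e (X B)) (symEll e (X B) (k0 + (N + J)))
    have q5 := hpos B (N+J)
    rw [Real.log_mul hc.ne' (by positivity), Real.log_mul q3.ne' (by positivity),
      Real.log_mul (by positivity) (by positivity), Real.log_pow, Real.log_pow,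
      Real.log_mul q4.ne' q5.ne', map_add, map_add, map_add, map_add, hcnt,
      ← nsmul_eq_mul, ← nsmul_eq_mul, map_nsmul, map_nsmul, nsmul_eq_mul, nsmul_eq_mul] at e2
    have e3 := hCst (j, pat B (N+J))
    simp only [map_add] at e3
    change (cnt (e (X B)) (symEll e (X B) (k0 + (N + J))) j : ℚ) ≤ _
    linarith
  set n := Fintype.card β with hn
  have hlen : ∀ z l, ∑ j, cnt z l j = l := by
    intro z l
    have := Finset.card_eq_sum_card_fiberwise (f := z) (s := Finset.range l) (t := Finset.univ)
      (fun t _ => Finset.mem_coe.2 (Finset.mem_univ _))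
    rw [Finset.card_range] at this
    exact this.symm
  set d1 : ℚ := (b1 : ℚ) / a1
  set d2 : ℚ := (b2 : ℚ) / a2 with hd2
  have hd1n : 0 ≤ d1 := by positivity
  have hd2n : 0 ≤ d2 := by positivity
  -- bound on the number of letters other than `j1`
  have hK : ∀ N J, ∀ B ∈ (Finset.range (N+J)).powersetCard J,
      ((∑ j ∈ Finset.univ.erase j1, cnt (e (X B)) (ll B (N+J)) j : ℕ) : ℚ) ≤ d2 * J + n * Cst := by
    intro N J B hB
    push_cast
    calc ∑ j ∈ Finset.univ.erase j1, (cnt (e (X B)) (ll B (N+J)) j : ℚ)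
        ≤ ∑ j ∈ Finset.univ.erase j1, ((if j2 = j then d2 * J else 0) + (Cst : ℚ)) := by
          refine Finset.sum_le_sum fun j hj => (hbound N J B hB j).trans ?_
          rw [hψ1, hψ2, if_neg (Finset.ne_of_mem_erase hj).symm]
          split_ifs <;> linarith
      _ ≤ ∑ j, ((if j2 = j then d2 * J else 0) + (Cst : ℚ)) := by
          refine Finset.sum_le_sum_of_subset_of_nonneg (Finset.subset_univ _) fun j _ _ => ?_
          split_ifs <;> positivity
      _ = d2 * J + n * Cst := by
          rw [Finset.sum_add_distrib]
          simp [hn]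
  have hH : ∀ N J, ∀ B ∈ (Finset.range (N+J)).powersetCard J,
      (ll B (N+J) : ℚ) ≤ d1 * N + (2 * (d2 * J + n * Cst) + Cst) := by
    intro N J B hB
    have e1 := hK N J B hB
    have e2 := hbound N J B hB j1
    rw [hψ1, hψ2, if_pos rfl] at e2
    have e3 := hlen (e (X B)) (ll B (N+J))
    rw [← Finset.add_sum_erase _ _ (Finset.mem_univ j1)] at e3
    have e4 : (ll B (N+J) : ℚ) = (cnt (e (X B)) (ll B (N+J)) j1 : ℚ) +
      ((∑ j ∈ Finset.univ.erase j1, cnt (e (X B)) (ll B (N+J)) j : ℕ) : ℚ) := by exact_mod_cast e3.symm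
    have e5 : (J : ℚ) * (if j2 = j1 then d2 else 0) ≤ d2 * J + n * Cst := by
      have : (0:ℚ) ≤ n * Cst := by positivity
      split_ifs
      · linarith
      · have : 0 ≤ d2 * J := by positivity
        linarith
    rw [e4]
    linarith
  -- counting
  have hcount : ∀ J : ℕ, (J : ℚ) ≤ d2 * J + n * Cst + 2 := by
    intro J
    set K := ⌊d2 * J + n * Cst⌋₊ with hKdef
    set A := ⌈d1⌉₊
    set A' := ⌈2 * (d2 * J + n * Cst) + Cst⌉₊
    have key : J ≤ K + 1 := by
      apply growth (A := A) (A' := A') (n := n) (Z := Fintype.card (Finset (Fin L → β)))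
      intro N
      set H := A * N + A' with hHdef
      have hlH : ∀ B ∈ (Finset.range (N+J)).powersetCard J, ll B (N+J) ≤ H := by
        intro B hB
        have e1 := hH N J B hB
        have e2 : d1 ≤ A := Nat.le_ceil _
        have e3 : 2 * (d2 * J + n * Cst) + Cst ≤ (A' : ℚ) := Nat.le_ceil _
        have e4 : (ll B (N+J) : ℚ) ≤ ((A * N + A' : ℕ) : ℚ) := by
          push_cast
          have : d1 * N ≤ A * N := mul_le_mul_of_nonneg_right e2 (Nat.cast_nonneg _)
          linarith
        exact_mod_cast e4
      let code : Finset ℕ → Finset (ℕ × β) := fun B =>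
        ((Finset.range (ll B (N+J))).filter fun t => e (X B) t ≠ j1).image fun t => (t, e (X B) t)
      have hcode : ∀ B t j, (t, j) ∈ code B ↔ t < ll B (N+J) ∧ e (X B) t ≠ j1 ∧ e (X B) t = j := by
        intro B t j
        simp only [code, Finset.mem_image, Finset.mem_filter, Finset.mem_range, Prod.mk.injEq]
        constructor
        · rintro ⟨t', ⟨g1, g2⟩, rfl, rfl⟩; exact ⟨g1, g2, rfl⟩
        · rintro ⟨g1, g2, rfl⟩; exact ⟨t, ⟨g1, g2⟩, rfl, rfl⟩
      have hcodecard : ∀ B ∈ (Finset.range (N+J)).powersetCard J, (code B).card ≤ K := by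
        intro B hB
        apply Nat.le_floor
        refine le_trans ?_ (hK N J B hB)
        have e1 : (code B).card ≤ ((Finset.range (ll B (N+J))).filter fun t => e (X B) t ≠ j1).card :=
          Finset.card_image_le
        have e2 := Finset.card_eq_sum_card_fiberwise (f := e (X B))
          (s := (Finset.range (ll B (N+J))).filter fun t => e (X B) t ≠ j1)
          (t := Finset.univ.erase j1) (fun t ht => by
            have := (Finset.mem_filter.1 (Finset.mem_coe.1 ht)).2
            exact Finset.mem_coe.2 (Finset.mem_erase.2 ⟨this, Finset.mem_univ _⟩))
        have e3 : ∑ j ∈ Finset.univ.erase j1, (((Finset.range (ll B (N+J))).filter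
            fun t => e (X B) t ≠ j1).filter fun t => e (X B) t = j).card ≤
            ∑ j ∈ Finset.univ.erase j1, cnt (e (X B)) (ll B (N+J)) j := by
          refine Finset.sum_le_sum fun j _ => Finset.card_le_card ?_
          exact Finset.filter_subset_filter _ (Finset.filter_subset _ _)
        exact_mod_cast e1.trans (e2.le.trans e3)
      let T : Finset (ℕ × (Finset (ℕ × β) × Finset (Fin L → β))) :=
        Finset.range (H+1) ×ˢ
          ((((Finset.range H) ×ˢ (Finset.univ : Finset β)).powerset.filter fun T => T.card ≤ K) ×ˢ
            Finset.univ)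
      let F : Finset ℕ → ℕ × (Finset (ℕ × β) × Finset (Fin L → β)) := fun B =>
        (ll B (N+J), code B, pat B (N+J))
      have hFT : ∀ B ∈ (Finset.range (N+J)).powersetCard J, F B ∈ T := by
        intro B hB
        simp only [F, T, Finset.mem_product, Finset.mem_range, Finset.mem_filter, Finset.mem_powerset,
          Finset.mem_univ, and_true]
        have e1 := hlH B hB
        refine ⟨by omega, ?_, hcodecard B hB⟩
        rintro ⟨t, j⟩ htj
        rw [hcode] at htj
        simp only [Finset.mem_product, Finset.mem_range, Finset.mem_univ, and_true]
        omega
      have hFinj : Set.InjOn F ((Finset.range (N+J)).powersetCard J) := by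
        intro B hB B' hB' hFF
        simp only [F, Prod.mk.injEq] at hFF
        obtain ⟨g1, g2, g3⟩ := hFF
        have hB1 := (Finset.mem_powersetCard.1 (Finset.mem_coe.1 hB)).1
        have hB2 := (Finset.mem_powersetCard.1 (Finset.mem_coe.1 hB')).1
        have g4 : ∀ t < ll B (N+J), e (X B) t = e (X B') t := by
          intro t ht
          by_cases g5 : e (X B) t = j1
          · by_contra g6
            have g7 : (t, e (X B') t) ∈ code B' := by
              rw [hcode]
              exact ⟨by omega, fun g8 => g6 (by rw [g5, g8]), rfl⟩
            rw [← g2, hcode] at g7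
            exact g7.2.1 g5
          · have g7 : (t, e (X B) t) ∈ code B := by
              rw [hcode]
              exact ⟨ht, g5, rfl⟩
            rw [g2, hcode] at g7
            exact g7.2.2.symm
        have g5 : e '' cylinder (X B) (k0 + (N + J)) = e '' cylinder (X B') (k0 + (N + J)) := by
          rw [hshape B (N+J), hshape B' (N+J), ← g3]
          change SymShape _ (ll B (N+J)) _ _ = SymShape _ (ll B' (N+J)) _ _
          rw [← g1]
          ext w
          simp only [SymShape, Set.mem_ofPred_eq]
          refine and_congr_left fun _ => forall₂_congr fun t ht => ?_
          rw [g4 t ht]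
        have g6 := (Set.image_injective.2 e.injective) g5
        have g7 : X B ∈ cylinder (X B') (k0 + (N + J)) := by
          rw [← g6]; exact self_mem_cylinder _ _
        ext t
        by_cases ht : t < N + J
        · have g8 := g7 (k0 + t) (by omega)
          have hXadd : ∀ D : Finset ℕ, X D (k0 + t) = if t ∈ D then i2 else i1 := by
            intro D
            simp only [X]
            rw [if_neg (by omega), Nat.add_sub_cancel_left]
          rw [hXadd, hXadd] at g8
          by_cases u1 : t ∈ B <;> by_cases u2 : t ∈ B' <;> simp [u1, u2] at g8 ⊢
          · exact hi g8.symm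
          · exact hi g8
        · constructor
          · intro hh; exact absurd (Finset.mem_range.1 (hB1 hh)) ht
          · intro hh; exact absurd (Finset.mem_range.1 (hB2 hh)) ht
      have hcard := Finset.card_le_card_of_injOn F hFT hFinj
      rw [Finset.card_powersetCard, Finset.card_range] at hcard
      refine hcard.trans ?_
      simp only [T, Finset.card_product, Finset.card_range, Finset.card_univ]
      have e1 := card_small_subsets ((Finset.range H) ×ˢ (Finset.univ : Finset β)) K
      rw [Finset.card_product, Finset.card_range, Finset.card_univ, ← hn] at e1
      gcongr
    have e1 : (K : ℚ) ≤ d2 * J + n * Cst := Nat.floor_le (by positivity)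
    have e2 : (J : ℚ) ≤ K + 1 := by exact_mod_cast key
    linarith
  by_contra hcon
  have hd : d2 < 1 := by
    rw [hd2, div_lt_one (by exact_mod_cast ha2)]
    exact_mod_cast not_le.1 hcon
  obtain ⟨J, hJ⟩ := exists_nat_gt ((n * Cst + 2) / (1 - d2))
  rw [div_lt_iff₀ (by linarith)] at hJ
  have := hcount J
  linarith

end Count

section Final
open PiNat

lemma letters_eq {α β : Type} [Fintype α] [Fintype β] [Nontrivial α] [Nontrivial β]
    {p : α → ℝ} {q : β → ℝ} (hp : ∀ i, p i ∈ Set.Ioo (0:ℝ) 1)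
    (hq : ∀ i, q i ∈ Set.Ioo (0:ℝ) 1) (hpind : LinearIndependent ℚ fun i => Real.log (p i))
    (hqind : LinearIndependent ℚ fun j => Real.log (q j))
    {e : (ℕ → α) ≃ (ℕ → β)} (h : SymCore p q e) (h' : SymCore q p e.symm) (i : α) :
    ∃ j, p i = q j := by
  have s1 := semigroup_of_core hp hq h
  have s2 := semigroup_of_core hq hp h'
  obtain ⟨j, a, b, ha, hb, hab⟩ := commensurable hp hq hpind s1 s2 i
  obtain ⟨i', hi'⟩ := exists_ne i
  obtain ⟨j', a', b', ha', hb', hab'⟩ := commensurable hp hq hpind s1 s2 i'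
  obtain ⟨k, hk⟩ := exists_ne j
  obtain ⟨k', u, v, hu, hv, huv⟩ := commensurable hq hp hqind s2 s1 k
  have l1 : a ≤ b := count_of_core hp hq hqind h hi' ha' ha hab' hab
  have l2 : b ≤ a := count_of_core hq hp hpind h' hk hu hb huv hab.symm
  obtain rfl := le_antisymm l1 l2
  exact ⟨j, (pow_left_inj₀ (hp i).1.le (hq j).1.le ha.ne').1 hab⟩

lemma log_rpow_ind {α : Type} {ρ : α → ℝ} (hρ : ∀ i, ρ i ∈ Set.Ioo (0:ℝ) 1)
    (hind : LinearIndependent ℚ fun i => Real.log (ρ i)) {s : ℝ} (hs : 0 < s) :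
    LinearIndependent ℚ fun i => Real.log (ρ i ^ s) := by
  have h1 := hind.map' (LinearMap.mulLeft ℚ s) (LinearMap.ker_eq_bot.2 fun x y hxy =>
    mul_left_cancel₀ hs.ne' hxy)
  have h2 : (fun i => Real.log (ρ i ^ s)) =
      ⇑(LinearMap.mulLeft ℚ s) ∘ fun i => Real.log (ρ i) := by
    funext i
    simp [Real.log_rpow (hρ i).1]
  rw [h2]
  exact h1

end Final

theorem stmt2 {d d' m n : ℕ} (hm : 2 ≤ m) (hn : 2 ≤ n)
    (ρ : Fin m → ℝ) (τ : Fin n → ℝ)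
    (hρ : ∀ i, ρ i ∈ Set.Ioo (0 : ℝ) 1) (hτ : ∀ k, τ k ∈ Set.Ioo (0 : ℝ) 1)
    (hρind : LinearIndependent ℚ fun i => Real.log (ρ i))
    (hτind : LinearIndependent ℚ fun k => Real.log (τ k))
    (E : Set (EuclideanSpace ℝ (Fin d))) (F : Set (EuclideanSpace ℝ (Fin d')))
    (hE : IsDustLike E ρ) (hF : IsDustLike F τ) :
    LipEquiv E F ↔ (Finset.univ.val.map ρ = Finset.univ.val.map τ) := by
  have hρinj : Function.Injective ρ := fun i j hij => hρind.injective (by simp only [hij])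
  have hτinj : Function.Injective τ := fun i j hij => hτind.injective (by simp only [hij])
  have nm : Nontrivial (Fin m) := Fin.nontrivial_iff_two_le.2 hm
  have nn : Nontrivial (Fin n) := Fin.nontrivial_iff_two_le.2 hn
  constructor
  · intro h
    obtain ⟨e, C, hC, hBL⟩ := exists_symBL hE hF h
    obtain ⟨s, hs, hss⟩ := exists_dim_s2 hρ
    obtain ⟨t, ht, htt⟩ := exists_dim_s2 hτ
    have h1 := dim_le hρ hτ hC hBL hs ht hss htt
    have h2 := dim_le hτ hρ hC hBL.symm ht hs htt hss
    obtain rfl := le_antisymm h1 h2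
    have c1 := symCore_of_BL hρ hτ hC hBL hs hss htt
    have c2 := symCore_of_BL hτ hρ hC hBL.symm hs htt hss
    have p1 := rpow_mem_Ioo hρ hs
    have p2 := rpow_mem_Ioo hτ hs
    have i1 := log_rpow_ind hρ hρind hs
    have i2 := log_rpow_ind hτ hτind hs
    have m1 : ∀ i, ∃ j, ρ i = τ j := by
      intro i
      obtain ⟨j, hj⟩ := letters_eq p1 p2 i1 i2 c1 c2 i
      exact ⟨j, (Real.rpow_left_inj (hρ i).1.le (hτ j).1.le hs.ne').1 hj⟩
    have m2 : ∀ j, ∃ i, τ j = ρ i := by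
      intro j
      obtain ⟨i, hi⟩ := letters_eq p2 p1 i2 i1 c2 (by simpa using c1) j
      exact ⟨i, (Real.rpow_left_inj (hτ j).1.le (hρ i).1.le hs.ne').1 hi⟩
    refine (Multiset.Nodup.ext (Finset.univ.nodup.map hρinj) (Finset.univ.nodup.map hτinj)).2 ?_
    intro a
    simp only [Multiset.mem_map, Finset.mem_val, Finset.mem_univ, true_and]
    constructor
    · rintro ⟨i, rfl⟩
      obtain ⟨j, hj⟩ := m1 i
      exact ⟨j, hj.symm⟩
    · rintro ⟨j, rfl⟩
      obtain ⟨i, hi⟩ := m2 j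
      exact ⟨i, hi.symm⟩
  · intro h
    have hr : Set.range ρ = Set.range τ := by
      ext a
      have := congrArg (fun S => a ∈ S) h
      simpa using this
    let σ : Fin m ≃ Fin n := (Equiv.ofInjective ρ hρinj).trans
      ((Equiv.setCongr hr).trans (Equiv.ofInjective τ hτinj).symm)
    refine lipEquiv_of_perm hE hF σ fun i => ?_
    simp only [σ, Equiv.trans_apply]
    rw [Equiv.apply_ofInjective_symm hτinj]
    rfl
end
end

section
/- Let ρ = (ρ_1,…,ρ_m) and τ = (τ_1,…,τ_n) have all entries in (0,1). Then the following are equivalent: (a) there exist positive integers p and q such that sgp(ρ_1^p,…,ρ_m^p) ⊆ sgp(τ_1,…,τ_n) and sgp(τ_1^q,…,τ_n^q) ⊆ sgp(ρ_1,…,ρ_m); (b) V_ρ⁺ = V_τ⁺. -/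
open scoped BigOperators

noncomputable section

/-- `V_ρ⁺`: nonnegative rational combinations of the `log ρ_i`. -/
def Vplus {m : ℕ} (ρ : Fin m → ℝ) : Set ℝ :=
  { x | ∃ q : Fin m → ℚ, (∀ i, 0 ≤ q i) ∧ x = ∑ i, (q i : ℝ) * Real.log (ρ i) }

theorem stmt4_aux1 {m n : ℕ} (ρ : Fin m → ℝ) (τ : Fin n → ℝ)
    (hτ : ∀ k, τ k ∈ Set.Ioo (0 : ℝ) 1) (p : ℕ) (hp : 0 < p)
    (h : sgp (fun i => ρ i ^ p) ⊆ sgp τ) : Vplus ρ ⊆ Vplus τ := by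
  have key : ∀ i, ∃ N : Fin n → ℕ, (p : ℝ) * Real.log (ρ i) = ∑ k, (N k : ℝ) * Real.log (τ k) := by
    intro i
    have hi : ρ i ^ p ∈ sgp (fun i => ρ i ^ p) := by
      refine ⟨fun j => if j = i then 1 else 0, by simp, ?_⟩
      simp [pow_ite, Finset.prod_ite_eq']
    obtain ⟨N, -, hN⟩ := h hi
    refine ⟨N, ?_⟩
    rw [← Real.log_pow, hN, Real.log_prod (fun k _ => pow_ne_zero _ (hτ k).1.ne')]
    simp [Real.log_pow]
  choose N hN using key
  rintro x ⟨q, hq, rfl⟩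
  have hp' : (p : ℝ) ≠ 0 := by positivity
  refine ⟨fun k => ∑ i, q i * (N i k : ℚ) / p, fun k => Finset.sum_nonneg fun i _ => ?_, ?_⟩
  · have := hq i
    positivity
  · push_cast
    simp_rw [Finset.sum_mul]
    rw [Finset.sum_comm]
    refine Finset.sum_congr rfl fun i _ => ?_
    have : Real.log (ρ i) = (∑ k, (N i k : ℝ) * Real.log (τ k)) / p := by
      rw [← hN i]; field_simp
    rw [this, Finset.sum_div, Finset.mul_sum]
    refine Finset.sum_congr rfl fun k _ => ?_
    ring

theorem stmt4_aux2 {m n : ℕ} (ρ : Fin m → ℝ) (τ : Fin n → ℝ)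
    (hρ : ∀ i, ρ i ∈ Set.Ioo (0 : ℝ) 1) (hτ : ∀ k, τ k ∈ Set.Ioo (0 : ℝ) 1)
    (h : Vplus ρ ⊆ Vplus τ) : ∃ p : ℕ, 0 < p ∧ sgp (fun i => ρ i ^ p) ⊆ sgp τ := by
  have key : ∀ i, ∃ Q : Fin n → ℚ, (∀ k, 0 ≤ Q k) ∧
      Real.log (ρ i) = ∑ k, (Q k : ℝ) * Real.log (τ k) := by
    intro i
    refine h ⟨fun j => if j = i then 1 else 0, fun j => by dsimp only; split_ifs <;> simp, ?_⟩
    rw [Finset.sum_eq_single i (fun j _ hj => by simp [hj]) (by simp)]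
    simp
  choose Q hQ0 hQ using key
  set p : ℕ := ∏ i, ∏ k, (Q i k).den with hp
  have hp0 : 0 < p := Finset.prod_pos fun i _ => Finset.prod_pos fun k _ => (Q i k).den_pos
  have hN : ∀ i k, ∃ N : ℕ, (p : ℚ) * Q i k = N := by
    intro i k
    have hd : (Q i k).den ∣ p :=
      (Finset.dvd_prod_of_mem (fun k => (Q i k).den) (Finset.mem_univ k)).trans
        (Finset.dvd_prod_of_mem (fun i => ∏ k, (Q i k).den) (Finset.mem_univ i))
    obtain ⟨c, hc⟩ := hd
    refine ⟨c * (Q i k).num.toNat, ?_⟩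
    have h1 : (((Q i k).num.toNat : ℤ)) = (Q i k).num :=
      Int.toNat_of_nonneg (Rat.num_nonneg.2 (hQ0 i k))
    have h2 : (((Q i k).num.toNat : ℕ) : ℚ) = ((Q i k).num : ℚ) := by exact_mod_cast congrArg (Int.cast (R := ℚ)) h1
    have h3 := Rat.mul_den_eq_num (Q i k)
    rw [hc]
    push_cast
    rw [h2, ← h3]
    ring
  choose N hN using hN
  have hpow : ∀ i, ρ i ^ p = ∏ k, τ k ^ N i k := by
    intro i
    apply Real.log_injOn_pos (Set.mem_Ioi.2 (pow_pos (hρ i).1 _))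
      (Set.mem_Ioi.2 (Finset.prod_pos fun k _ => pow_pos (hτ k).1 _))
    rw [Real.log_prod (fun k _ => pow_ne_zero _ (hτ k).1.ne'), Real.log_pow, hQ i, Finset.mul_sum]
    refine Finset.sum_congr rfl fun k _ => ?_
    have : (p : ℝ) * (Q i k : ℝ) = N i k := by exact_mod_cast congrArg (Rat.cast (K := ℝ)) (hN i k)
    rw [Real.log_pow, ← this]
    ring
  refine ⟨p, hp0, ?_⟩
  rintro x ⟨e, he, rfl⟩
  have hx : ∏ i, (ρ i ^ p) ^ e i = ∏ k, τ k ^ (∑ i, N i k * e i) := by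
    simp_rw [hpow, ← Finset.prod_pow, ← pow_mul, ← Finset.prod_pow_eq_pow_sum]
    rw [Finset.prod_comm]
  refine ⟨fun k => ∑ i, N i k * e i, ?_, hx⟩
  by_contra hlt
  have h0 : ∑ k, ∑ i, N i k * e i = 0 := by
    dsimp only at hlt
    omega
  have h0' : ∀ k, ∑ i, N i k * e i = 0 := fun k =>
    (Finset.sum_eq_zero_iff.1 h0) k (Finset.mem_univ k)
  simp only [h0', pow_zero, Finset.prod_const_one] at hx
  obtain ⟨i, -, hi⟩ : ∃ i ∈ Finset.univ, e i ≠ 0 := by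
    by_contra! hcon
    rw [Finset.sum_eq_zero hcon] at he
    omega
  have : ∏ i, (ρ i ^ p) ^ e i < ∏ i : Fin m, (1 : ℝ) := by
    refine Finset.prod_lt_prod (fun j _ => pow_pos (pow_pos (hρ j).1 _) _)
      (fun j _ => pow_le_one₀ (pow_pos (hρ j).1 _).le (pow_le_one₀ (hρ j).1.le (hρ j).2.le))
      ⟨i, Finset.mem_univ i, pow_lt_one₀ (pow_pos (hρ i).1 _).le
        (pow_lt_one₀ (hρ i).1.le (hρ i).2 hp0.ne') hi⟩
  rw [hx] at this
  simp at this

theorem stmt4 {m n : ℕ} (ρ : Fin m → ℝ) (τ : Fin n → ℝ)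
    (hρ : ∀ i, ρ i ∈ Set.Ioo (0 : ℝ) 1) (hτ : ∀ k, τ k ∈ Set.Ioo (0 : ℝ) 1) :
    (∃ p q : ℕ, 0 < p ∧ 0 < q ∧
        sgp (fun i => ρ i ^ p) ⊆ sgp τ ∧ sgp (fun k => τ k ^ q) ⊆ sgp ρ) ↔
      Vplus ρ = Vplus τ := by
  constructor
  · rintro ⟨p, q, hp, hq, h1, h2⟩
    exact Set.Subset.antisymm (stmt4_aux1 ρ τ hτ p hp h1) (stmt4_aux1 τ ρ hρ q hq h2)
  · intro h
    obtain ⟨p, hp, h1⟩ := stmt4_aux2 ρ τ hρ hτ h.subset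
    obtain ⟨q, hq, h2⟩ := stmt4_aux2 τ ρ hτ hρ h.symm.subset
    exact ⟨p, q, hp, hq, h1, h2⟩
end
end
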